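/- Tr = {Tr_n}_{n≥1} is a Markov trace on the tower of algebras {Y_{d,n}^B}_{n≥1}; that is, for every n ≥ 1 the linear map Tr_n : Y_{d,n}^B → L satisfies: (i) Tr_n(1) = 1; (ii) Tr_{n+1}(X g_n) = z·Tr_n(X) for all X ∈ Y_{d,n}^B; (iii) Tr_{n+1}(X b_{n+1} t_{n+1}^m) = y_m·Tr_n(X) for all X ∈ Y_{d,n}^B and 0 ≤ m ≤ d−1; (iv) Tr_{n+1}(X t_{n+1}^m) = x_m·Tr_n(X) for all X ∈ Y_{d,n}^B and 0 ≤ m ≤ d−1; (v) Tr_n(XY) = Tr_n(YX) for all X, Y ∈ Y_{d,n}^B. -/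

import Mathlib

set_option maxHeartbeats 1000000
set_option synthInstance.maxHeartbeats 400000

noncomputable section

/-- The field `L = ℂ(u,v,z)` of rational functions in three indeterminates over `ℂ`. -/
abbrev Kf : Type := FractionRing (MvPolynomial (Fin 3) ℂ)

/-- The indeterminate `u`. -/
def uu : Kf := algebraMap (MvPolynomial (Fin 3) ℂ) Kf (MvPolynomial.X 0)

/-- The indeterminate `v`. -/
def vv : Kf := algebraMap (MvPolynomial (Fin 3) ℂ) Kf (MvPolynomial.X 1)

/-- The indeterminate `z`. -/
def zz : Kf := algebraMap (MvPolynomial (Fin 3) ℂ) Kf (MvPolynomial.X 2)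

/-- Generators of the framization of the Hecke algebra of type B on `n` strands:
`b` is the generator `b₁`, `g i` is the braiding generator `g_{i+1}` (`i : Fin (n-1)`),
and `t j` is the framing generator `t_{j+1}` (`j : Fin n`). -/
inductive Gen (n : ℕ) : Type
  | b : Gen n
  | g : Fin (n - 1) → Gen n
  | t : Fin n → Gen n

/-- The free algebra on the generators. -/
abbrev FA (n : ℕ) : Type := FreeAlgebra Kf (Gen n)

/-- The generator `b₁` in the free algebra. -/
def Bb (n : ℕ) : FA n := FreeAlgebra.ι Kf Gen.b

/-- The generator `g_i` (for `1 ≤ i ≤ n-1`) in the free algebra; junk value `1` out of range. -/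
def Gg (n i : ℕ) : FA n :=
  if h : 1 ≤ i ∧ i ≤ n - 1 then FreeAlgebra.ι Kf (Gen.g ⟨i - 1, by omega⟩) else 1

/-- The generator `t_j` (for `1 ≤ j ≤ n`) in the free algebra; junk value `1` out of range. -/
def Tt (n j : ℕ) : FA n :=
  if h : 1 ≤ j ∧ j ≤ n then FreeAlgebra.ι Kf (Gen.t ⟨j - 1, by omega⟩) else 1

/-- The element `e_i = (1/d) ∑_{m=0}^{d-1} t_i^m t_{i+1}^{d-m}` in the free algebra. -/
def eF (d n i : ℕ) : FA n :=
  (d : Kf)⁻¹ • ∑ m ∈ Finset.range d, Tt n i ^ m * Tt n (i + 1) ^ (d - m)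

/-- The element `f₁ = (1/d) ∑_{m=0}^{d-1} t₁^m` in the free algebra. -/
def fF (d n : ℕ) : FA n :=
  (d : Kf)⁻¹ • ∑ m ∈ Finset.range d, Tt n 1 ^ m

/-- The action of the simple transposition `s_i` on indices: swaps `i` and `i+1`. -/
def sAct (i j : ℕ) : ℕ := if j = i then i + 1 else if j = i + 1 then i else j

/-- The defining relations of the framization `Y_{d,n}^B` of the Hecke algebra of type B. -/
inductive YBrel (d n : ℕ) : FA n → FA n → Prop
  | gg : ∀ i j : ℕ, 1 ≤ i → i ≤ n - 1 → 1 ≤ j → j ≤ n - 1 → (i + 1 < j ∨ j + 1 < i) →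
      YBrel d n (Gg n i * Gg n j) (Gg n j * Gg n i)
  | braid : ∀ i : ℕ, 1 ≤ i → i ≤ n - 2 →
      YBrel d n (Gg n i * Gg n (i + 1) * Gg n i) (Gg n (i + 1) * Gg n i * Gg n (i + 1))
  | bg : ∀ i : ℕ, 2 ≤ i → i ≤ n - 1 → YBrel d n (Bb n * Gg n i) (Gg n i * Bb n)
  | bgbg : YBrel d n (Bb n * Gg n 1 * Bb n * Gg n 1) (Gg n 1 * Bb n * Gg n 1 * Bb n)
  | tt : ∀ i j : ℕ, 1 ≤ i → i ≤ n → 1 ≤ j → j ≤ n →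
      YBrel d n (Tt n i * Tt n j) (Tt n j * Tt n i)
  | tg : ∀ i j : ℕ, 1 ≤ i → i ≤ n - 1 → 1 ≤ j → j ≤ n →
      YBrel d n (Tt n j * Gg n i) (Gg n i * Tt n (sAct i j))
  | tb : ∀ i : ℕ, 1 ≤ i → i ≤ n → YBrel d n (Tt n i * Bb n) (Bb n * Tt n i)
  | td : ∀ i : ℕ, 1 ≤ i → i ≤ n → YBrel d n (Tt n i ^ d) 1
  | gsq : ∀ i : ℕ, 1 ≤ i → i ≤ n - 1 →
      YBrel d n (Gg n i ^ 2) (1 + (uu - uu⁻¹) • (eF d n i * Gg n i))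
  | bsq : YBrel d n (Bb n ^ 2) (1 + (vv - vv⁻¹) • (fF d n * Bb n))

/-- The framization of the Hecke algebra of type B, `Y_{d,n}^B`. -/
abbrev YB (d n : ℕ) : Type := RingQuot (YBrel d n)

instance (d n : ℕ) : Ring (YB d n) := RingQuot.instRing (YBrel d n)

instance (d n : ℕ) : Algebra Kf (YB d n) := RingQuot.instAlgebra _

instance (d n : ℕ) : Module Kf (YB d n) := Algebra.toModule

/-- The canonical projection from the free algebra onto `Y_{d,n}^B`. -/
def mkY (d n : ℕ) : FA n →ₐ[Kf] YB d n := RingQuot.mkAlgHom Kf (YBrel d n)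

/-- The generator `b₁` of `Y_{d,n}^B`. -/
def bY (d n : ℕ) : YB d n := mkY d n (Bb n)

/-- The generator `g_i` of `Y_{d,n}^B`. -/
def gY (d n : ℕ) (i : ℕ) : YB d n := mkY d n (Gg n i)

/-- The generator `t_j` of `Y_{d,n}^B`. -/
def tY (d n : ℕ) (j : ℕ) : YB d n := mkY d n (Tt n j)

/-- The idempotent `e_i` of `Y_{d,n}^B`. -/
def eY (d n : ℕ) (i : ℕ) : YB d n := mkY d n (eF d n i)

/-- The idempotent `f₁` of `Y_{d,n}^B`. -/
def fY (d n : ℕ) : YB d n := mkY d n (fF d n)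

/-- The element `g_i⁻¹ = g_i - (u - u⁻¹) e_i`. -/
def gInv (d n i : ℕ) : YB d n := gY d n i - (uu - uu⁻¹) • eY d n i

/-- The elements `b_k := g_{k-1} ⋯ g_1 b_1 g_1⁻¹ ⋯ g_{k-1}⁻¹` for `2 ≤ k ≤ n`,
defined by `b_k = g_{k-1} b_{k-1} g_{k-1}⁻¹`; with `b_1` the generator `b₁`. -/
def bk (d n : ℕ) : ℕ → YB d n
  | 0 => 1
  | 1 => bY d n
  | (k + 2) => gY d n (k + 1) * bk d n (k + 1) * gInv d n (k + 1)

/-- The descending product `g_{k-1} g_{k-2} ⋯ g_j`. -/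
def gRange (d n j k : ℕ) : YB d n := (((List.range' j (k - j)).reverse).map (gY d n)).prod

/-- The elements `𝔪⁺_{k,j,m}`: `𝔪⁺_{k,k,m} = t_k^m` and
`𝔪⁺_{k,j,m} = g_{k-1} ⋯ g_j t_j^m` for `j < k`. -/
def mPlus (d n k j m : ℕ) : YB d n :=
  if j = k then tY d n k ^ m else gRange d n j k * tY d n j ^ m

/-- The elements `𝔪⁻_{k,j,m}`: `𝔪⁻_{k,k,m} = t_k^m b_k` and
`𝔪⁻_{k,j,m} = g_{k-1} ⋯ g_j b_j t_j^m` for `j < k`. -/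
def mMinus (d n k j m : ℕ) : YB d n :=
  if j = k then tY d n k ^ m * bk d n k else gRange d n j k * (bk d n j * tY d n j ^ m)

/-- The subsets `M_{d,k}` of `Y_{d,n}^B`:
`M_{d,1} = {t₁^m, t₁^m b₁}` and `M_{d,k} = {t_k^m, t_k^m b_k, g_{k-1} x : x ∈ M_{d,k-1}}`. -/
def Mset (d n : ℕ) : ℕ → Set (YB d n)
  | 0 => {1}
  | 1 => {x | ∃ m ≤ d - 1, x = tY d n 1 ^ m ∨ x = tY d n 1 ^ m * bY d n}
  | (k + 2) => {x |
      (∃ m ≤ d - 1, x = tY d n (k + 2) ^ m ∨ x = tY d n (k + 2) ^ m * bk d n (k + 2)) ∨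
      ∃ y ∈ Mset d n (k + 1), x = gY d n (k + 1) * y}

/-- The set `𝖢_n` of all products `𝔪_1 𝔪_2 ⋯ 𝔪_n` with `𝔪_i ∈ M_{d,i}`. -/
def Cset (d n : ℕ) : Set (YB d n) :=
  {x | ∃ f : Fin n → YB d n, (∀ i : Fin n, f i ∈ Mset d n (i.val + 1)) ∧
    x = (List.ofFn f).prod}

/-- Characterization of the natural inclusion `Y_{d,n}^B ⊆ Y_{d,n+1}^B`:
the algebra map sending generators to the generators of the same name. -/
def IsIncl (d n : ℕ) (inc : YB d n →ₐ[Kf] YB d (n + 1)) : Prop :=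
  inc (bY d n) = bY d (n + 1) ∧
  (∀ i, 1 ≤ i → i ≤ n - 1 → inc (gY d n i) = gY d (n + 1) i) ∧
  (∀ j, 1 ≤ j → j ≤ n → inc (tY d n j) = tY d (n + 1) j)

/-- Characterization of the relative trace `tr_{n+1} : Y_{d,n+1}^B → Y_{d,n}^B`
(with respect to trace parameters `x`, `y`): it is the `L`-linear map defined on the
basis `𝖢_{n+1}` by `tr(w t_{n+1}^m) = x_m w`, `tr(w b_{n+1} t_{n+1}^m) = y_m w`, and
`tr(w 𝔪^±_{n+1,k,m}) = z (w 𝔪^±_{n,k,m})` for `k < n+1`, where `w ∈ 𝖢_n`. -/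
def IsRelTrace (d : ℕ) (x y : ZMod d → Kf) (n : ℕ)
    (inc : YB d n →ₐ[Kf] YB d (n + 1)) (tr : YB d (n + 1) →ₗ[Kf] YB d n) : Prop :=
  ∀ w ∈ Cset d n, ∀ m : ℕ, m ≤ d - 1 →
    (tr (inc w * tY d (n + 1) (n + 1) ^ m) = x (m : ZMod d) • w) ∧
    (tr (inc w * (bk d (n + 1) (n + 1) * tY d (n + 1) (n + 1) ^ m)) = y (m : ZMod d) • w) ∧
    (∀ k, 1 ≤ k → k ≤ n →
      tr (inc w * mPlus d (n + 1) (n + 1) k m) = zz • (w * mPlus d n n k m) ∧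
      tr (inc w * mMinus d (n + 1) (n + 1) k m) = zz • (w * mMinus d n n k m))

/-- Characterization of the trace `tr_1 : Y_{d,1}^B → L`:
`tr_1(t₁^a) = x_a` and `tr_1(b₁ t₁^a) = y_a`. -/
def IsTr1 (d : ℕ) (x y : ZMod d → Kf) (tr1 : YB d 1 →ₗ[Kf] Kf) : Prop :=
  ∀ a : ℕ, a ≤ d - 1 →
    tr1 (tY d 1 1 ^ a) = x (a : ZMod d) ∧ tr1 (bY d 1 * tY d 1 1 ^ a) = y (a : ZMod d)

/-- The Markov trace tower `Tr_{m+1} = tr_1 ∘ tr_2 ∘ ⋯ ∘ tr_{m+1} : Y_{d,m+1}^B → L`,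
built from the relative traces (`tr k` here is the relative trace
`tr_{k+2} : Y_{d,k+2}^B → Y_{d,k+1}^B`). -/
def TrT (d : ℕ) (tr1 : YB d 1 →ₗ[Kf] Kf)
    (tr : (k : ℕ) → (YB d (k + 2) →ₗ[Kf] YB d (k + 1))) :
    (m : ℕ) → (YB d (m + 1) →ₗ[Kf] Kf)
  | 0 => tr1
  | (m + 1) => (TrT d tr1 tr m).comp (tr m)

section Tower

variable {K R A B D : Type*} [Field K] [AddCommGroup R] [Fintype R]
  [Ring A] [Algebra K A] [Ring B] [Algebra K B] [Ring D] [Algebra K D]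

/-- The unnormalised idempotent `∑ r, t_{k}^r t_{k+1}^{-r}`, where the powers of the framing
generators are indexed by a finite abelian group `R`. -/
def twistSum (i : A →ₐ[K] B) (T₀ : R → A) (T : R → B) : B := ∑ r, i (T₀ r) * T (-r)

/-- The relations between the top generators `t_k`, `b_k` (`T₀`, `b₀`) of an algebra `A` and the new
generators `t_{k+1}`, `b_{k+1}`, `g_k` (`T`, `b`, `g`) of the next algebra `B` of the tower. -/
structure BraidStep (κ : K) (i : A →ₐ[K] B) (T₀ : R → A) (b₀ : A) (T : R → B) (b g : B) :
    Prop where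
  T₀_add : ∀ r s, T₀ (r + s) = T₀ r * T₀ s
  T₀_b₀ : ∀ r, T₀ r * b₀ = b₀ * T₀ r
  T_zero : T 0 = 1
  T_add : ∀ r s, T (r + s) = T r * T s
  T_map : ∀ r a, T r * i a = i a * T r
  T_b : ∀ r, T r * b = b * T r
  T_g : ∀ r, T r * g = g * i (T₀ r)
  g_T : ∀ r, g * T r = i (T₀ r) * g
  g_sq : g * g = 1 + κ • (twistSum i T₀ T * g)
  b_g : b * g = g * i b₀
  quad : g * (i b₀ * (g * i b₀)) = i b₀ * (g * (i b₀ * g))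

namespace BraidStep

variable {κ : K} {i : A →ₐ[K] B} {T₀ : R → A} {b₀ : A} {T : R → B} {b g : B}

theorem twist_g (h : BraidStep κ i T₀ b₀ T b g) :
    twistSum i T₀ T * g = g * twistSum i T₀ T := by
  unfold twistSum
  rw [Finset.sum_mul, Finset.mul_sum, ← Equiv.sum_comp (Equiv.neg R)]
  refine Finset.sum_congr rfl fun r _ => ?_
  simp only [Equiv.neg_apply, neg_neg]
  rw [mul_assoc, h.T_g, ← mul_assoc, ← h.g_T, mul_assoc, h.T_map]

theorem map_twist (h : BraidStep κ i T₀ b₀ T b g) {a : A} (ha : ∀ r, T₀ r * a = a * T₀ r) :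
    i a * twistSum i T₀ T = twistSum i T₀ T * i a := by
  unfold twistSum
  rw [Finset.sum_mul, Finset.mul_sum]
  refine Finset.sum_congr rfl fun r _ => ?_
  rw [mul_assoc, h.T_map, ← mul_assoc, ← mul_assoc, ← map_mul, ← map_mul, ha]

theorem g_mul_inv (h : BraidStep κ i T₀ b₀ T b g) : g * (g - κ • twistSum i T₀ T) = 1 := by
  rw [mul_sub, h.g_sq, h.twist_g, mul_smul_comm, add_sub_cancel_right]

theorem inv_mul_g (h : BraidStep κ i T₀ b₀ T b g) : (g - κ • twistSum i T₀ T) * g = 1 := by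
  rw [sub_mul, h.g_sq, smul_mul_assoc, add_sub_cancel_right]

theorem b_eq (h : BraidStep κ i T₀ b₀ T b g) : b = g * (i b₀ * (g - κ • twistSum i T₀ T)) := by
  rw [← mul_assoc, ← h.b_g, mul_assoc, h.g_mul_inv, mul_one]

theorem g_b (h : BraidStep κ i T₀ b₀ T b g) :
    g * b = i b₀ * g + κ • (twistSum i T₀ T * (b - i b₀)) := by
  have : g * b = (g * g) * (i b₀ * (g - κ • twistSum i T₀ T)) := by
    conv_lhs => rw [h.b_eq]
    rw [mul_assoc]
  rw [this, h.g_sq, add_mul, one_mul, smul_mul_assoc, mul_assoc, ← h.b_eq, mul_sub, mul_sub,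
    smul_sub, mul_smul_comm, h.map_twist h.T₀_b₀]
  abel

theorem g_b₀_b (h : BraidStep κ i T₀ b₀ T b g) : g * (i b₀ * b) = i b₀ * (g * i b₀) := by
  have : g * (i b₀ * b) = (g * (i b₀ * (g * i b₀))) * (g - κ • twistSum i T₀ T) := by
    conv_lhs => rw [h.b_eq]
    simp only [mul_assoc]
  rw [this, h.quad]
  simp only [mul_assoc]
  rw [h.g_mul_inv, mul_one]

theorem T_comm (h : BraidStep κ i T₀ b₀ T b g) (r s : R) : T r * T s = T s * T r := by
  rw [← h.T_add, add_comm, h.T_add]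

theorem T₀_comm (h : BraidStep κ i T₀ b₀ T b g) (r s : R) : T₀ r * T₀ s = T₀ s * T₀ r := by
  rw [← h.T₀_add, add_comm, h.T₀_add]

/-- Right multiples of `T r * g` rewritten through `g`. -/
theorem T_g_assoc (h : BraidStep κ i T₀ b₀ T b g) (r : R) (c : B) :
    T r * (g * c) = g * (i (T₀ r) * c) := by
  rw [← mul_assoc, h.T_g, mul_assoc]

theorem g_T_assoc (h : BraidStep κ i T₀ b₀ T b g) (r : R) (c : B) :
    g * (T r * c) = i (T₀ r) * (g * c) := by
  rw [← mul_assoc, h.g_T, mul_assoc]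

theorem T_map_assoc (h : BraidStep κ i T₀ b₀ T b g) (r : R) (a : A) (c : B) :
    T r * (i a * c) = i a * (T r * c) := by
  rw [← mul_assoc, h.T_map, mul_assoc]

theorem b_g_assoc (h : BraidStep κ i T₀ b₀ T b g) (c : B) :
    b * (g * c) = g * (i b₀ * c) := by
  rw [← mul_assoc, h.b_g, mul_assoc]

end BraidStep

end Tower

section Tower

variable {K R A B D : Type*} [Field K] [AddCommGroup R] [Fintype R]
  [Ring A] [Algebra K A] [Ring B] [Algebra K B] [Ring D] [Algebra K D]

/-- The span of all differences `a g a' - c g c'` with `a a' = c c'`. -/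
def slideSpan (i : A →ₐ[K] B) (G : Set B) : Submodule K B :=
  Submodule.span K {X | ∃ g ∈ G, ∃ a a' c c' : A, a * a' = c * c' ∧
    X = i a * (g * i a') - i c * (g * i c')}

theorem map_mul_mem_slideSpan {i : A →ₐ[K] B} {G : Set B} {X : B} (hX : X ∈ slideSpan i G)
    (w : A) : i w * X ∈ slideSpan i G := by
  induction hX using Submodule.span_induction with
  | mem X hX =>
    obtain ⟨g, hg, a, a', c, c', h, rfl⟩ := hX
    refine Submodule.subset_span ⟨g, hg, w * a, a', w * c, c', ?_, ?_⟩
    · rw [mul_assoc, h, mul_assoc]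
    · simp only [map_mul, mul_sub, mul_assoc]
  | zero => rw [mul_zero]; exact zero_mem _
  | add X Y _ _ hX hY => rw [mul_add]; exact add_mem hX hY
  | smul k X _ hX => rw [mul_smul_comm]; exact Submodule.smul_mem _ _ hX

theorem mul_map_mem_slideSpan {i : A →ₐ[K] B} {G : Set B} {X : B} (hX : X ∈ slideSpan i G)
    (w : A) : X * i w ∈ slideSpan i G := by
  induction hX using Submodule.span_induction with
  | mem X hX =>
    obtain ⟨g, hg, a, a', c, c', h, rfl⟩ := hX
    refine Submodule.subset_span ⟨g, hg, a, a' * w, c, c' * w, ?_, ?_⟩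
    · rw [← mul_assoc, h, mul_assoc]
    · simp only [map_mul, sub_mul, mul_assoc]
  | zero => rw [zero_mul]; exact zero_mem _
  | add X Y _ _ hX hY => rw [add_mul]; exact add_mem hX hY
  | smul k X _ hX => rw [smul_mul_assoc]; exact Submodule.smul_mem _ _ hX

/-- One floor `A → B` of the tower, with its relative trace `τ : B → A`. The elements
`T r`, `b` are the top framing and loop generators of `B`, the set `G` contains the top braiding
generator (it is empty at the bottom of the tower) and `H` consists of elements of `A` commuting
with `b`. -/
structure Floor (κ z : K) (x y : R → K) (i : A →ₐ[K] B) (τ : B →ₗ[K] A)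
    (T₀ : R → A) (b₀ : A) (T : R → B) (b : B) (G : Set B) (H : Set A) : Prop where
  T_zero : T 0 = 1
  T_add : ∀ r s, T (r + s) = T r * T s
  T_map : ∀ r a, T r * i a = i a * T r
  T_b : ∀ r, T r * b = b * T r
  b_map : ∀ r a, T r * (b * i a) - i a * (T r * b) ∈ slideSpan i G
  subsingleton : G.Subsingleton
  braid : ∀ g ∈ G, BraidStep κ i T₀ b₀ T b g
  b_H : ∀ h ∈ H, b * i h = i h * b
  τ_T : ∀ a r, τ (i a * T r) = x r • a
  τ_Tb : ∀ a r, τ (i a * (T r * b)) = y r • a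
  τ_g : ∀ g ∈ G, ∀ a c, τ (i a * (g * i c)) = z • (a * c)
  span_eq_top : Submodule.span K {X | ∃ a r, X = i a * T r ∨ X = i a * (T r * b) ∨
    ∃ g ∈ G, ∃ h ∈ H, X = i a * (T r * (g * i h)) ∨ X = i a * (T r * (b * (g * i h)))} = ⊤

/-- The two kinds of non-braiding words `T r` and `T r * b`, with their trace parameters. -/
inductive Decor (x y : R → K) (b₀ : A) (b : B) : A → B → (R → K) → Prop
  | one : Decor x y b₀ b 1 1 x
  | loop : Decor x y b₀ b b₀ b y

namespace Floor

variable {κ z : K} {x y : R → K} {i : A →ₐ[K] B} {τ : B →ₗ[K] A}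
  {T₀ : R → A} {b₀ : A} {T : R → B} {b : B} {G : Set B} {H : Set A}

theorem induction (F : Floor κ z x y i τ T₀ b₀ T b G H) {p : B → Prop}
    (zero : p 0) (add : ∀ X Y, p X → p Y → p (X + Y)) (smul : ∀ (k : K) X, p X → p (k • X))
    (decor : ∀ β₀ β ξ, Decor x y b₀ b β₀ β ξ → ∀ a r, p (i a * (T r * β)))
    (braid : ∀ g ∈ G, ∀ a c, p (i a * (g * i c))) (X : B) : p X := by
  have hX : X ∈ (⊤ : Submodule K B) := trivial
  rw [← F.span_eq_top] at hX
  induction hX using Submodule.span_induction with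
  | mem X hX =>
    obtain ⟨a, r, rfl | rfl | ⟨g, hg, h, hh, rfl | rfl⟩⟩ := hX
    · simpa using decor _ _ _ .one a r
    · exact decor _ _ _ .loop a r
    · rw [(F.braid g hg).T_g_assoc]
      simpa only [map_mul] using braid g hg a (T₀ r * h)
    · rw [(F.braid g hg).b_g_assoc, (F.braid g hg).T_g_assoc]
      simpa only [map_mul] using braid g hg a (T₀ r * (b₀ * h))
  | zero => exact zero
  | add X Y _ _ hX hY => exact add X Y hX hY
  | smul k X _ hX => exact smul k X hX

theorem τ_decor (F : Floor κ z x y i τ T₀ b₀ T b G H) {β₀ : A} {β : B} {ξ : R → K}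
    (h : Decor x y b₀ b β₀ β ξ) (a : A) (r : R) : τ (i a * (T r * β)) = ξ r • a := by
  cases h with
  | one => rw [mul_one, F.τ_T]
  | loop => rw [F.τ_Tb]

theorem decor_map (F : Floor κ z x y i τ T₀ b₀ T b G H) {β₀ : A} {β : B} {ξ : R → K}
    (h : Decor x y b₀ b β₀ β ξ) (r : R) (a : A) :
    T r * (β * i a) - i a * (T r * β) ∈ slideSpan i G := by
  cases h with
  | one => rw [one_mul, mul_one, F.T_map, sub_self]; exact zero_mem _
  | loop => exact F.b_map r a

theorem τ_slideSpan (F : Floor κ z x y i τ T₀ b₀ T b G H) {X : B} (hX : X ∈ slideSpan i G) :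
    τ X = 0 := by
  induction hX using Submodule.span_induction with
  | mem X hX =>
    obtain ⟨g, hg, a, a', c, c', h, rfl⟩ := hX
    rw [map_sub, F.τ_g g hg, F.τ_g g hg, h, sub_self]
  | zero => exact map_zero τ
  | add X Y _ _ hX hY => rw [map_add, hX, hY, add_zero]
  | smul k X _ hX => rw [map_smul, hX, smul_zero]

theorem τ_decor_map (F : Floor κ z x y i τ T₀ b₀ T b G H) {β₀ : A} {β : B} {ξ : R → K}
    (h : Decor x y b₀ b β₀ β ξ) (r : R) (a : A) : τ (T r * (β * i a)) = ξ r • a := by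
  have := F.τ_slideSpan (F.decor_map h r a)
  rw [map_sub, sub_eq_zero] at this
  rw [this, F.τ_decor h]

theorem τ_map_mul (F : Floor κ z x y i τ T₀ b₀ T b G H) (w : A) (X : B) :
    τ (i w * X) = w * τ X := by
  induction X using F.induction with
  | zero => simp
  | add X Y hX hY => rw [mul_add, map_add, hX, hY, map_add, mul_add]
  | smul k X hX => rw [mul_smul_comm, map_smul, hX, map_smul, mul_smul_comm]
  | decor β₀ β ξ h a r =>
    rw [F.τ_decor h, ← mul_assoc, ← map_mul, F.τ_decor h, mul_smul_comm]
  | braid g hg a c =>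
    rw [F.τ_g g hg, ← mul_assoc, ← map_mul, F.τ_g g hg, mul_smul_comm, mul_assoc]

theorem τ_mul_map (F : Floor κ z x y i τ T₀ b₀ T b G H) (X : B) (w : A) :
    τ (X * i w) = τ X * w := by
  induction X using F.induction with
  | zero => simp
  | add X Y hX hY => rw [add_mul, map_add, hX, hY, map_add, add_mul]
  | smul k X hX => rw [smul_mul_assoc, map_smul, hX, map_smul, smul_mul_assoc]
  | decor β₀ β ξ h a r =>
    rw [F.τ_decor h, mul_assoc, F.τ_map_mul, mul_assoc, F.τ_decor_map h, mul_smul_comm,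
      smul_mul_assoc]
  | braid g hg a c =>
    rw [F.τ_g g hg, mul_assoc, mul_assoc, ← map_mul, F.τ_g g hg, smul_mul_assoc, mul_assoc]

end Floor

end Tower

section WordSpan

variable {K R B D : Type*} [Field K] [Ring B] [Algebra K B] [Ring D] [Algebra K D]

/-- The span of the words `j X T' r`, `j X T' r b'` and `j X g j Y`. -/
def wordSpan (j : B →ₐ[K] D) (T' : R → D) (b' g : D) : Submodule K D :=
  Submodule.span K {Z | (∃ X r, Z = j X * T' r) ∨ (∃ X r, Z = j X * (T' r * b')) ∨
    ∃ X Y, Z = j X * (g * j Y)}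

variable {j : B →ₐ[K] D} {T' : R → D} {b' g : D}

theorem wordSpan_T (X : B) (r : R) : j X * T' r ∈ wordSpan j T' b' g :=
  Submodule.subset_span (.inl ⟨X, r, rfl⟩)

theorem wordSpan_Tb (X : B) (r : R) : j X * (T' r * b') ∈ wordSpan j T' b' g :=
  Submodule.subset_span (.inr (.inl ⟨X, r, rfl⟩))

theorem wordSpan_g (X Y : B) : j X * (g * j Y) ∈ wordSpan j T' b' g :=
  Submodule.subset_span (.inr (.inr ⟨X, Y, rfl⟩))

theorem slideSpan_le_wordSpan : slideSpan j {g} ≤ wordSpan j T' b' g := by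
  refine Submodule.span_le.2 ?_
  rintro Z ⟨g, rfl, a, a', c, c', -, rfl⟩
  exact sub_mem (wordSpan_g _ _) (wordSpan_g _ _)

theorem wordSpan_induction {p : (Z : D) → Z ∈ wordSpan j T' b' g → Prop}
    (zero : p 0 (zero_mem _)) (add : ∀ X Y hX hY, p X hX → p Y hY → p (X + Y) (add_mem hX hY))
    (smul : ∀ (k : K) X hX, p X hX → p (k • X) (Submodule.smul_mem _ k hX))
    (hT : ∀ X r, p (j X * T' r) (wordSpan_T X r))
    (hb : ∀ X r, p (j X * (T' r * b')) (wordSpan_Tb X r))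
    (hg : ∀ X Y, p (j X * (g * j Y)) (wordSpan_g X Y)) {Z : D} (hZ : Z ∈ wordSpan j T' b' g) :
    p Z hZ := by
  induction hZ using Submodule.span_induction with
  | mem Z hZ =>
    obtain ⟨X, r, rfl⟩ | ⟨X, r, rfl⟩ | ⟨X, Y, rfl⟩ := hZ
    · exact hT X r
    · exact hb X r
    · exact hg X Y
  | zero => exact zero
  | add X Y _ _ hX hY => exact add X Y _ _ hX hY
  | smul k X _ hX => exact smul k X _ hX

theorem map_mul_mem_wordSpan {Z : D} (hZ : Z ∈ wordSpan j T' b' g) (W : B) :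
    j W * Z ∈ wordSpan j T' b' g := by
  induction hZ using wordSpan_induction with
  | zero => rw [mul_zero]; exact zero_mem _
  | add X Y _ _ hX hY => rw [mul_add]; exact add_mem hX hY
  | smul k X _ hX => rw [mul_smul_comm]; exact Submodule.smul_mem _ _ hX
  | hT X r => rw [← mul_assoc, ← map_mul]; exact wordSpan_T _ _
  | hb X r => rw [← mul_assoc, ← map_mul]; exact wordSpan_Tb _ _
  | hg X r => rw [← mul_assoc, ← map_mul]; exact wordSpan_g _ _

end WordSpan

theorem Decor.lift {K R A B D : Type*} [Ring A] [Ring B] [Ring D] {x y : R → K}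
    {b₀ : A} {b : B} {β₀ : A} {β : B} {ξ : R → K}
    (h : Decor x y b₀ b β₀ β ξ) (b' : D) : ∃ β', Decor x y b b' β β' ξ := by
  cases h with
  | one => exact ⟨1, .one⟩
  | loop => exact ⟨b', .loop⟩

section Tower

variable {K R A B D : Type*} [Field K] [AddCommGroup R] [Fintype R]
  [Ring A] [Algebra K A] [Ring B] [Algebra K B] [Ring D] [Algebra K D]

namespace BraidStep

variable {κ : K} {i : A →ₐ[K] B} {T₀ : R → A} {b₀ : A} {T : R → B} {b g : B}
  {x y : R → K} {β₀ : A} {β : B} {ξ : R → K}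

theorem T_twist (h : BraidStep κ i T₀ b₀ T b g) (r : R) :
    T r * twistSum i T₀ T = twistSum i T₀ T * T r := by
  unfold twistSum
  rw [Finset.sum_mul, Finset.mul_sum]
  refine Finset.sum_congr rfl fun s _ => ?_
  rw [h.T_map_assoc, h.T_comm, mul_assoc]

theorem inv_T (h : BraidStep κ i T₀ b₀ T b g) (r : R) :
    (g - κ • twistSum i T₀ T) * i (T₀ r) = T r * (g - κ • twistSum i T₀ T) := by
  have e : T r * (g * (g - κ • twistSum i T₀ T)) = g * (i (T₀ r) * (g - κ • twistSum i T₀ T)) :=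
    h.T_g_assoc r _
  rw [h.g_mul_inv, mul_one] at e
  have e₂ : g * (T r * (g - κ • twistSum i T₀ T)) = i (T₀ r) * (g * (g - κ • twistSum i T₀ T)) :=
    h.g_T_assoc r _
  rw [h.g_mul_inv, mul_one] at e₂
  rw [← e₂, ← mul_assoc, h.inv_mul_g, one_mul]

theorem b_T₀ (h : BraidStep κ i T₀ b₀ T b g) (r : R) : b * i (T₀ r) = i (T₀ r) * b := by
  rw [h.b_eq]
  simp only [mul_assoc]
  rw [h.inv_T, ← h.g_T_assoc, h.T_map_assoc]

theorem b_twist (h : BraidStep κ i T₀ b₀ T b g) :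
    b * twistSum i T₀ T = twistSum i T₀ T * b := by
  unfold twistSum
  rw [Finset.sum_mul, Finset.mul_sum]
  refine Finset.sum_congr rfl fun s _ => ?_
  rw [← mul_assoc, h.b_T₀, mul_assoc, mul_assoc, h.T_b]

theorem decor_g (h : BraidStep κ i T₀ b₀ T b g) (hβ : Decor x y b₀ b β₀ β ξ) :
    β * g = g * i β₀ := by
  cases hβ with
  | one => simp
  | loop => exact h.b_g

theorem decor_twist (h : BraidStep κ i T₀ b₀ T b g) (hβ : Decor x y b₀ b β₀ β ξ) :
    β * twistSum i T₀ T = twistSum i T₀ T * β := by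
  cases hβ with
  | one => simp
  | loop => exact h.b_twist

theorem g_decor_g (h : BraidStep κ i T₀ b₀ T b g) (hβ : Decor x y b₀ b β₀ β ξ) (r : R) :
    g * (i (T₀ r * β₀) * g) =
      T r * β + κ • ∑ s, i (T₀ s) * (g * i (T₀ (r - s) * β₀)) := by
  have e : g * (i (T₀ r * β₀) * g) = T r * (β * (g * g)) := by
    rw [map_mul, mul_assoc, ← h.T_g_assoc, ← mul_assoc β, h.decor_g hβ, mul_assoc]
  rw [e, h.g_sq, mul_add, mul_add, mul_one, mul_smul_comm, mul_smul_comm, ← mul_assoc β,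
    h.decor_twist hβ, mul_assoc, h.decor_g hβ, ← mul_assoc, h.T_twist]
  congr 2
  rw [twistSum, Finset.sum_mul, Finset.sum_mul]
  refine Finset.sum_congr rfl fun s _ => ?_
  simp only [mul_assoc]
  rw [h.T_g_assoc r, h.T_g_assoc (-s), ← mul_assoc (i _) (i _), ← map_mul, ← h.T₀_add,
    ← map_mul, neg_add_eq_sub]

end BraidStep

/-- The data extending a floor `A → B` of the tower to the next floor `B → D`. -/
structure FloorStep (κ : K) (i : A →ₐ[K] B) (T : R → B) (b : B) (G : Set B) (H : Set A)
    (j : B →ₐ[K] D) (T' : R → D) (b' g : D) (H' : Set B) : Prop where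
  braid : BraidStep κ j T b T' b' g
  g_map : ∀ a, g * j (i a) = j (i a) * g
  braid_rel : ∀ g₁ ∈ G, g * (j g₁ * g) = j g₁ * (g * j g₁)
  b_map : ∀ r X, T' r * (b' * j X) - j X * (T' r * b') ∈ slideSpan j {g}
  one_mem : 1 ∈ H'
  mul_mem : ∀ g₁ ∈ G, ∀ h ∈ H, g₁ * i h ∈ H'
  b_H : ∀ h ∈ H', b' * j h = j h * b'
  adjoin_eq_top : Algebra.adjoin K (Set.range j ∪ ({g} ∪ Set.range T')) = ⊤

namespace FloorStep

variable {κ z : K} {x y : R → K} {i : A →ₐ[K] B} {τ : B →ₗ[K] A}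
  {T₀ : R → A} {b₀ : A} {T : R → B} {b : B} {G : Set B} {H : Set A}
  {j : B →ₐ[K] D} {T' : R → D} {b' g : D} {H' : Set B}

theorem g_map_assoc (S : FloorStep κ i T b G H j T' b' g H') (a : A) (c : D) :
    g * (j (i a) * c) = j (i a) * (g * c) := by
  rw [← mul_assoc, S.g_map, mul_assoc]

theorem g_map_g_mem (S : FloorStep κ i T b G H j T' b' g H')
    (F : Floor κ z x y i τ T₀ b₀ T b G H) (Y : B) : g * (j Y * g) ∈ wordSpan j T' b' g := by
  induction Y using F.induction with
  | zero => rw [map_zero, zero_mul, mul_zero]; exact zero_mem _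
  | add X Y hX hY => rw [map_add, add_mul, mul_add]; exact add_mem hX hY
  | smul k X hX =>
    rw [map_smul, smul_mul_assoc, mul_smul_comm]; exact Submodule.smul_mem _ _ hX
  | decor β₀ β ξ hβ a r =>
    obtain ⟨β', hβ'⟩ := hβ.lift b'
    rw [map_mul, mul_assoc, S.g_map_assoc, S.braid.g_decor_g hβ']
    refine map_mul_mem_wordSpan (add_mem ?_ (Submodule.smul_mem _ _ (sum_mem fun s _ => ?_))) _
    · cases hβ' with
      | one => simpa using wordSpan_T (j := j) (T' := T') (b' := b') (g := g) 1 r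
      | loop => simpa using wordSpan_Tb (j := j) (T' := T') (b' := b') (g := g) 1 r
    · exact wordSpan_g _ _
  | braid g₁ hg₁ a c =>
    have e : g * (j (i a * (g₁ * i c)) * g) = j (i a * g₁) * (g * j (g₁ * i c)) := by
      simp only [map_mul, mul_assoc]
      rw [S.g_map_assoc, ← S.g_map, ← mul_assoc (j g₁), ← mul_assoc g, S.braid_rel g₁ hg₁]
      simp only [mul_assoc]
    rw [e]
    exact wordSpan_g _ _

theorem mul_map_mem_wordSpan (S : FloorStep κ i T b G H j T' b' g H') {Z : D}
    (hZ : Z ∈ wordSpan j T' b' g) (Y : B) : Z * j Y ∈ wordSpan j T' b' g := by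
  induction hZ using wordSpan_induction with
  | zero => rw [zero_mul]; exact zero_mem _
  | add X Y _ _ hX hY => rw [add_mul]; exact add_mem hX hY
  | smul k X _ hX => rw [smul_mul_assoc]; exact Submodule.smul_mem _ _ hX
  | hT X r => rw [mul_assoc, S.braid.T_map, ← mul_assoc, ← map_mul]; exact wordSpan_T _ _
  | hb X r =>
    rw [mul_assoc, mul_assoc]
    refine map_mul_mem_wordSpan ?_ _
    have := add_mem (slideSpan_le_wordSpan (T' := T') (b' := b') (S.b_map r Y))
      (wordSpan_Tb (j := j) (T' := T') (b' := b') (g := g) Y r)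
    rwa [sub_add_cancel] at this
  | hg X W => rw [mul_assoc, mul_assoc, ← map_mul]; exact wordSpan_g _ _

theorem mul_T_mem_wordSpan (S : FloorStep κ i T b G H j T' b' g H') {Z : D}
    (hZ : Z ∈ wordSpan j T' b' g) (r : R) : Z * T' r ∈ wordSpan j T' b' g := by
  induction hZ using wordSpan_induction with
  | zero => rw [zero_mul]; exact zero_mem _
  | add X Y _ _ hX hY => rw [add_mul]; exact add_mem hX hY
  | smul k X _ hX => rw [smul_mul_assoc]; exact Submodule.smul_mem _ _ hX
  | hT X s => rw [mul_assoc, ← S.braid.T_add]; exact wordSpan_T _ _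
  | hb X s =>
    rw [mul_assoc, mul_assoc, ← S.braid.T_b, ← mul_assoc (T' s), ← S.braid.T_add]
    exact wordSpan_Tb _ _
  | hg X W =>
    rw [mul_assoc, mul_assoc, ← S.braid.T_map, S.braid.g_T_assoc, ← mul_assoc, ← map_mul]
    exact wordSpan_g _ _

theorem mul_g_mem_wordSpan (S : FloorStep κ i T b G H j T' b' g H')
    (F : Floor κ z x y i τ T₀ b₀ T b G H) {Z : D}
    (hZ : Z ∈ wordSpan j T' b' g) : Z * g ∈ wordSpan j T' b' g := by
  induction hZ using wordSpan_induction with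
  | zero => rw [zero_mul]; exact zero_mem _
  | add X Y _ _ hX hY => rw [add_mul]; exact add_mem hX hY
  | smul k X _ hX => rw [smul_mul_assoc]; exact Submodule.smul_mem _ _ hX
  | hT X s => rw [mul_assoc, S.braid.T_g]; exact wordSpan_g _ _
  | hb X s =>
    rw [mul_assoc, mul_assoc, S.braid.b_g, S.braid.T_g_assoc, ← map_mul]
    exact wordSpan_g _ _
  | hg X W =>
    rw [mul_assoc, mul_assoc]
    exact map_mul_mem_wordSpan (S.g_map_g_mem F W) X

theorem wordSpan_eq_top (S : FloorStep κ i T b G H j T' b' g H')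
    (F : Floor κ z x y i τ T₀ b₀ T b G H) : wordSpan j T' b' g = ⊤ := by
  refine Submodule.eq_top_iff'.2 fun Z => ?_
  have hZ : Z ∈ Algebra.adjoin K (Set.range j ∪ ({g} ∪ Set.range T')) := by
    rw [S.adjoin_eq_top]; trivial
  have key : ∀ W ∈ wordSpan j T' b' g, W * Z ∈ wordSpan j T' b' g := by
    induction hZ using Algebra.adjoin_induction with
    | mem Z hZ =>
      intro W hW
      obtain ⟨Y, rfl⟩ | rfl | ⟨r, rfl⟩ := hZ
      · exact S.mul_map_mem_wordSpan hW Y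
      · exact S.mul_g_mem_wordSpan F hW
      · exact S.mul_T_mem_wordSpan hW r
    | algebraMap k =>
      intro W hW
      rw [← Algebra.commutes, ← Algebra.smul_def]
      exact Submodule.smul_mem _ _ hW
    | add X Y _ _ hX hY => intro W hW; rw [mul_add]; exact add_mem (hX W hW) (hY W hW)
    | mul X Y _ _ hX hY => intro W hW; rw [← mul_assoc]; exact hY _ (hX W hW)
  have one : (1 : D) ∈ wordSpan j T' b' g := by
    simpa [S.braid.T_zero] using wordSpan_T (j := j) (T' := T') (b' := b') (g := g) 1 0
  simpa using key 1 one

/-- A floor, extended by one step and a relative trace with the prescribed values, is a floor. -/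
theorem floor (S : FloorStep κ i T b G H j T' b' g H')
    (F : Floor κ z x y i τ T₀ b₀ T b G H) {σ : D →ₗ[K] B}
    (hT : ∀ X r, σ (j X * T' r) = x r • X) (hb : ∀ X r, σ (j X * (T' r * b')) = y r • X)
    (hg : ∀ X Y, σ (j X * (g * j Y)) = z • (X * Y)) :
    Floor κ z x y j σ T b T' b' {g} H' where
  T_zero := S.braid.T_zero
  T_add := S.braid.T_add
  T_map := S.braid.T_map
  T_b := S.braid.T_b
  b_map := S.b_map
  subsingleton := Set.subsingleton_singleton
  braid := by rintro _ rfl; exact S.braid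
  b_H := S.b_H
  τ_T := hT
  τ_Tb := hb
  τ_g := by rintro _ rfl; exact hg
  span_eq_top := by
    rw [eq_top_iff, ← S.wordSpan_eq_top F]
    refine Submodule.span_le.2 ?_
    rintro Z (⟨X, r, rfl⟩ | ⟨X, r, rfl⟩ | ⟨X, Y, rfl⟩)
    · exact Submodule.subset_span ⟨X, r, .inl rfl⟩
    · exact Submodule.subset_span ⟨X, r, .inr (.inl rfl)⟩
    have hY : Y ∈ (⊤ : Submodule K B) := trivial
    rw [← F.span_eq_top] at hY
    rw [SetLike.mem_coe]
    induction hY using Submodule.span_induction with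
    | mem Y hY =>
      have e : ∀ a r h, j X * (g * j (i a * (T r * h))) = j (X * i a) * (T' r * (g * j h)) := by
        intro a r h
        simp only [map_mul, mul_assoc]
        rw [S.g_map_assoc, S.braid.T_g_assoc]
      have e' : ∀ a r h,
          j X * (g * j (i a * (T r * (b * h)))) = j (X * i a) * (T' r * (b' * (g * j h))) := by
        intro a r h
        rw [e, map_mul j b, S.braid.b_g_assoc]
      obtain ⟨a, r, rfl | rfl | ⟨g₁, hg₁, h, hh, rfl | rfl⟩⟩ := hY
      · rw [← mul_one (T r), e]
        exact Submodule.subset_span ⟨_, r, .inr (.inr ⟨g, rfl, 1, S.one_mem, .inl rfl⟩)⟩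
      · rw [← mul_one b, e']
        exact Submodule.subset_span ⟨_, r, .inr (.inr ⟨g, rfl, 1, S.one_mem, .inr rfl⟩)⟩
      · rw [e]
        exact Submodule.subset_span
          ⟨_, r, .inr (.inr ⟨g, rfl, _, S.mul_mem g₁ hg₁ h hh, .inl rfl⟩)⟩
      · rw [e']
        exact Submodule.subset_span
          ⟨_, r, .inr (.inr ⟨g, rfl, _, S.mul_mem g₁ hg₁ h hh, .inr rfl⟩)⟩
    | zero => rw [map_zero, mul_zero, mul_zero]; exact zero_mem _
    | add Y W _ _ hY hW => rw [map_add, mul_add, mul_add]; exact add_mem hY hW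
    | smul k Y _ hY =>
      rw [map_smul, mul_smul_comm, mul_smul_comm]; exact Submodule.smul_mem _ _ hY

end FloorStep

end Tower

section Tower

variable {K R A B D : Type*} [Field K] [AddCommGroup R] [Fintype R]
  [Ring A] [Algebra K A] [Ring B] [Algebra K B] [Ring D] [Algebra K D]

namespace Floor

variable {κ z : K} {x y : R → K} {i : A →ₐ[K] B} {τ : B →ₗ[K] A}
  {T₀ : R → A} {b₀ : A} {T : R → B} {b : B} {G : Set B} {H : Set A}

theorem τ_decor_g (F : Floor κ z x y i τ T₀ b₀ T b G H) {β₀ : A} {β : B} {ξ : R → K}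
    (hβ : Decor x y b₀ b β₀ β ξ) {g : B} (hg : g ∈ G) (a c : A) (r : R) :
    τ (i a * (T r * (β * (g * i c)))) = z • (a * (T₀ r * (β₀ * c))) := by
  have h := F.braid g hg
  rw [← mul_assoc β, h.decor_g hβ, mul_assoc, h.T_g_assoc, ← map_mul, ← map_mul, F.τ_g g hg]

theorem τ_decor_g_g (F : Floor κ z x y i τ T₀ b₀ T b G H) {β₀ : A} {β : B} {ξ : R → K}
    (hβ : Decor x y b₀ b β₀ β ξ) {g : B} (hg : g ∈ G) (a : A) (r : R) :
    τ (i a * (T r * (β * (g * g)))) =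
      ξ r • a + (κ * Fintype.card R * z) • (a * (T₀ r * β₀)) := by
  have h := F.braid g hg
  have e : T r * (β * (twistSum i T₀ T * g)) =
      ∑ s, i (T₀ s) * (g * i (T₀ (-s) * (T₀ r * β₀))) := by
    rw [← mul_assoc β, h.decor_twist hβ, mul_assoc, h.decor_g hβ, ← mul_assoc, h.T_twist,
      mul_assoc, h.T_g_assoc, twistSum, Finset.sum_mul]
    refine Finset.sum_congr rfl fun s _ => ?_
    rw [mul_assoc, h.T_g_assoc, map_mul i (T₀ (-s)), map_mul i (T₀ r)]
  rw [h.g_sq, mul_add, mul_one, mul_smul_comm, mul_add, mul_smul_comm, mul_add, mul_smul_comm,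
    map_add, map_smul, F.τ_decor hβ, e, F.τ_map_mul, map_sum]
  have e' : ∀ s, τ (i (T₀ s) * (g * i (T₀ (-s) * (T₀ r * β₀)))) =
      z • (T₀ 0 * (T₀ r * β₀)) := by
    intro s
    rw [F.τ_g g hg, ← mul_assoc, ← h.T₀_add, add_neg_cancel]
  rw [Finset.sum_congr rfl fun s _ => e' s, Finset.sum_const, Finset.card_univ, ← mul_assoc,
    ← h.T₀_add, zero_add, ← Nat.cast_smul_eq_nsmul K, mul_smul_comm, mul_smul_comm, smul_smul,
    smul_smul, mul_assoc]

/-- A bimodule endomorphism `Φ` with the values of `X ↦ σ (g X g)` is self-adjoint with respect to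
a trace `θ` factoring through the relative trace. -/
theorem adjoint_eq (F : Floor κ z x y i τ T₀ b₀ T b G H) {θ : B →ₗ[K] K} {θ₀ : A →ₗ[K] K}
    (hθ : ∀ X, θ X = θ₀ (τ X)) (hcomm : ∀ X Y, θ (X * Y) = θ (Y * X))
    (htw : ∀ g ∈ G, ∀ a, τ (twistSum i T₀ T * (g * (i a * g))) =
      τ (g * (i a * g) * twistSum i T₀ T))
    {Φ : B →ₗ[K] B} (map_mul' : ∀ a X, Φ (i a * X) = i a * Φ X)
    (mul_map' : ∀ a X, Φ (X * i a) = Φ X * i a)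
    (hdecor : ∀ β₀ β ξ, Decor x y b₀ b β₀ β ξ → ∀ r, Φ (T r * β) =
      ξ r • 1 + (κ * Fintype.card R * z) • (T r * β))
    (hbraid : ∀ g ∈ G, Φ g = z • (g * g)) (X Y : B) : θ (X * Φ Y) = θ (Φ X * Y) := by
  have hΦg : ∀ g ∈ G, ∀ a c, Φ (i a * (g * i c)) = z • (i a * (g * (g * i c))) := by
    intro g hg a c
    rw [map_mul', mul_map', hbraid g hg, smul_mul_assoc, mul_smul_comm, mul_assoc]
  have hΦd : ∀ β₀ β ξ, Decor x y b₀ b β₀ β ξ → ∀ a r, Φ (i a * (T r * β)) =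
      ξ r • i a + (κ * Fintype.card R * z) • (i a * (T r * β)) := by
    intro β₀ β ξ hβ a r
    rw [map_mul', hdecor _ _ _ hβ, mul_add, mul_smul_comm, mul_smul_comm, mul_one]
  have hcc : ∀ g ∈ G, ∀ a c a' c', θ (i a * (g * i c) * Φ (i a' * (g * i c'))) =
      θ (Φ (i a * (g * i c)) * (i a' * (g * i c'))) := by
    intro g hg a c a' c'
    have h := F.braid g hg
    have e : τ (g * (i (c * a') * (g * g))) = τ (g * (g * (i (c * a') * g))) := by
      have e₁ := F.τ_g g hg 1 (c * a')
      have e₂ := F.τ_g g hg (c * a') 1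
      simp only [map_one, one_mul, mul_one] at e₁ e₂
      have e₃ : g * (i (c * a') * (g * g)) =
          g * i (c * a') + κ • (g * (i (c * a') * g) * twistSum i T₀ T) := by
        rw [h.g_sq, h.twist_g]
        simp only [mul_add, mul_one, mul_smul_comm, mul_assoc]
      have e₄ : g * (g * (i (c * a') * g)) =
          i (c * a') * g + κ • (twistSum i T₀ T * (g * (i (c * a') * g))) := by
        rw [← mul_assoc g g, h.g_sq]
        simp only [add_mul, one_mul, smul_mul_assoc, mul_assoc]
      rw [e₃, e₄, map_add, map_add, map_smul, map_smul, htw g hg, e₁, e₂]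
    rw [hΦg g hg, hΦg g hg, mul_smul_comm, smul_mul_assoc, map_smul, map_smul, hθ, hθ]
    have e₁ : i a * (g * i c) * (i a' * (g * (g * i c'))) =
        i a * (g * (i (c * a') * (g * g)) * i c') := by
      simp only [map_mul, mul_assoc]
    have e₂ : i a * (g * (g * i c)) * (i a' * (g * i c')) =
        i a * (g * (g * (i (c * a') * g)) * i c') := by
      simp only [map_mul, mul_assoc]
    rw [e₁, e₂, F.τ_map_mul, F.τ_map_mul, F.τ_mul_map, F.τ_mul_map, e]
  have hslide : ∀ g ∈ G, ∀ W ∈ slideSpan i G, θ (W * Φ g) = θ (Φ W * g) := by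
    intro g hg W hW
    induction hW using Submodule.span_induction with
    | mem W hW =>
      obtain ⟨g', hg', a, a', c, c', -, rfl⟩ := hW
      obtain rfl := F.subsingleton hg hg'
      have e₁ := hcc g hg a a' 1 1
      have e₂ := hcc g hg c c' 1 1
      simp only [map_one, one_mul, mul_one] at e₁ e₂
      rw [sub_mul, map_sub, e₁, e₂, map_sub, sub_mul, map_sub]
    | zero => simp
    | add V W _ _ hV hW => rw [add_mul, map_add, hV, hW, map_add, add_mul, map_add]
    | smul k V _ hV => rw [smul_mul_assoc, map_smul, hV, map_smul, smul_mul_assoc, map_smul]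
  have hac : ∀ β₀ β ξ, Decor x y b₀ b β₀ β ξ → ∀ g ∈ G, ∀ a r a' c',
      θ (i a * (T r * β) * Φ (i a' * (g * i c'))) =
        θ (Φ (i a * (T r * β)) * (i a' * (g * i c'))) := by
    intro β₀ β ξ hβ g hg a r a' c'
    have e₁ : θ (i (c' * a) * (T r * β * i a') * Φ g) =
        θ (Φ (i (c' * a) * (T r * β * i a')) * g) := by
      have hd := map_mul_mem_slideSpan (F.decor_map hβ r a') (c' * a)
      have e₂ := hslide g hg _ hd
      have e₃ : θ (i (c' * a * a') * (T r * β) * Φ g) =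
          θ (Φ (i (c' * a * a') * (T r * β)) * g) := by
        generalize c' * a * a' = w
        have e₄ := F.τ_g g hg w 1
        have e₅ := F.τ_decor_g hβ hg w 1 r
        simp only [map_one, mul_one] at e₄ e₅
        rw [hΦd _ _ _ hβ, hbraid g hg, mul_smul_comm, map_smul, add_mul, smul_mul_assoc,
          smul_mul_assoc, map_add, map_smul, map_smul, hθ, hθ, hθ]
        simp only [mul_assoc]
        rw [F.τ_decor_g_g hβ hg, e₄, e₅]
        simp only [map_add, map_smul, smul_eq_mul]
        ring
      have e₄ : i (c' * a) * (T r * β * i a') =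
          i (c' * a) * (T r * (β * i a') - i a' * (T r * β)) + i (c' * a * a') * (T r * β) := by
        rw [mul_sub, ← mul_assoc (i _) (i a'), ← map_mul, sub_add_cancel, mul_assoc (T r)]
      rw [e₄, add_mul, map_add, e₂, e₃, map_add, add_mul, map_add]
    have e₂ : i a * (T r * β) * Φ (i a' * (g * i c')) = i a * (T r * β) * i a' * Φ g * i c' := by
      rw [map_mul', mul_map']
      simp only [mul_assoc]
    have e₃ : Φ (i (c' * a) * (T r * β * i a')) = i c' * (Φ (i a * (T r * β)) * i a') := by
      rw [← mul_map', ← map_mul']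
      simp only [map_mul, mul_assoc]
    have e₄ : Φ (i a * (T r * β)) * (i a' * (g * i c')) =
        Φ (i a * (T r * β)) * i a' * g * i c' := by
      simp only [mul_assoc]
    rw [e₂, e₄, hcomm, hcomm _ (i c')]
    rw [e₃] at e₁
    simp only [map_mul, mul_assoc] at e₁ ⊢
    exact e₁
  have haa : ∀ β₀ β ξ, Decor x y b₀ b β₀ β ξ → ∀ β₀' β' ξ', Decor x y b₀ b β₀' β' ξ' →
      ∀ a r a' r', θ (i a * (T r * β) * Φ (i a' * (T r' * β'))) =
        θ (Φ (i a * (T r * β)) * (i a' * (T r' * β'))) := by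
    intro β₀ β ξ hβ β₀' β' ξ' hβ' a r a' r'
    rw [hΦd _ _ _ hβ, hΦd _ _ _ hβ', mul_add, add_mul, map_add, map_add, mul_smul_comm,
      mul_smul_comm, smul_mul_assoc, smul_mul_assoc]
    congr 1
    rw [map_smul, map_smul, hθ, hθ, F.τ_mul_map, F.τ_decor hβ, ← mul_assoc, ← map_mul,
      F.τ_decor hβ']
    simp only [smul_mul_assoc, map_smul, smul_eq_mul]
    ring
  induction X using F.induction with
  | zero => simp
  | add V W hV hW => rw [add_mul, map_add, hV, hW, map_add, add_mul, map_add]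
  | smul k V hV => rw [smul_mul_assoc, map_smul, hV, map_smul, smul_mul_assoc, map_smul]
  | decor β₀ β ξ hβ a r =>
    induction Y using F.induction with
    | zero => simp
    | add V W hV hW => rw [map_add, mul_add, map_add, hV, hW, mul_add, map_add]
    | smul k V hV => rw [map_smul, mul_smul_comm, map_smul, hV, mul_smul_comm, map_smul]
    | decor β₀' β' ξ' hβ' a' r' => exact haa _ _ _ hβ _ _ _ hβ' a r a' r'
    | braid g hg a' c' => exact hac _ _ _ hβ g hg a r a' c'
  | braid g hg a c =>
    induction Y using F.induction with
    | zero => simp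
    | add V W hV hW => rw [map_add, mul_add, map_add, hV, hW, mul_add, map_add]
    | smul k V hV => rw [map_smul, mul_smul_comm, map_smul, hV, mul_smul_comm, map_smul]
    | decor β₀ β ξ hβ a' r =>
      rw [hcomm, ← hac _ _ _ hβ g hg, hcomm]
    | braid g' hg' a' c' =>
      obtain rfl := F.subsingleton hg hg'
      exact hcc g hg a c a' c'

end Floor

end Tower

section Tower

variable {K R A B D : Type*} [Field K] [AddCommGroup R] [Fintype R]
  [Ring A] [Algebra K A] [Ring B] [Algebra K B] [Ring D] [Algebra K D]

/-- The linear map `X ↦ σ (g X g)`. -/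
def sandwich (j : B →ₐ[K] D) (g : D) (σ : D →ₗ[K] B) : B →ₗ[K] B :=
  σ ∘ₗ LinearMap.mulLeft K g ∘ₗ LinearMap.mulRight K g ∘ₗ j.toLinearMap

theorem sandwich_apply (j : B →ₐ[K] D) (g : D) (σ : D →ₗ[K] B) (X : B) :
    sandwich j g σ X = σ (g * (j X * g)) := rfl

namespace FloorStep

variable {κ z : K} {x y : R → K} {i : A →ₐ[K] B} {τ : B →ₗ[K] A}
  {T₀ : R → A} {b₀ : A} {T : R → B} {b : B} {G : Set B} {H : Set A}
  {j : B →ₐ[K] D} {T' : R → D} {b' g : D} {H' : Set B} {σ : D →ₗ[K] B}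

theorem g_braid_g (S : FloorStep κ i T b G H j T' b' g H') {g₁ : B} (hg₁ : g₁ ∈ G) (a c : A) :
    g * (j (i a * (g₁ * i c)) * g) = j (i a * g₁) * (g * j (g₁ * i c)) := by
  simp only [map_mul, mul_assoc]
  rw [S.g_map_assoc, ← S.g_map, ← mul_assoc (j g₁), ← mul_assoc g, S.braid_rel g₁ hg₁]
  simp only [mul_assoc]

theorem σ_g_T (F' : Floor κ z x y j σ T b T' b' {g} H') (X Y : B) (r : R) :
    σ (j X * (T' r * (g * j Y))) = z • (X * (T r * Y)) := by
  rw [(F'.braid g rfl).T_g_assoc, ← map_mul, F'.τ_g g rfl]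

theorem twist_step (S : FloorStep κ i T b G H j T' b' g H')
    (F : Floor κ z x y i τ T₀ b₀ T b G H) (F' : Floor κ z x y j σ T b T' b' {g} H') (X : B) :
    σ (twistSum j T T' * (g * (j X * g))) = σ (g * (j X * g) * twistSum j T T') := by
  induction X using F.induction with
  | zero => simp
  | add X Y hX hY => simp only [map_add, add_mul, mul_add, hX, hY]
  | smul k X hX => simp only [map_smul, smul_mul_assoc, mul_smul_comm, hX]
  | decor β₀ β ξ hβ a r =>
    obtain ⟨β', hβ'⟩ := hβ.lift b'
    have e : g * (j (i a * (T r * β)) * g) = j (i a) * (T' r * (β' * (g * g))) := by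
      simp only [map_mul, mul_assoc]
      rw [S.g_map_assoc, ← mul_assoc β', S.braid.decor_g hβ', mul_assoc, S.braid.T_g_assoc]
    rw [e, ← mul_assoc, ← S.braid.map_twist fun r => F.T_map r a]
    simp only [mul_assoc]
    rw [← S.braid.twist_g, ← mul_assoc g (twistSum j T T'), ← S.braid.twist_g,
      mul_assoc, ← mul_assoc β' (twistSum j T T'), S.braid.decor_twist hβ', mul_assoc,
        ← mul_assoc (T' r) (twistSum j T T'),
      S.braid.T_twist, mul_assoc]
  | braid g₁ hg₁ a c =>
    have h := F.braid g₁ hg₁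
    rw [S.g_braid_g hg₁, twistSum, Finset.sum_mul, Finset.mul_sum, map_sum, map_sum]
    refine Finset.sum_congr rfl fun s _ => ?_
    have e₁ : j (T s) * T' (-s) * (j (i a * g₁) * (g * j (g₁ * i c))) =
        j (i a * (g₁ * i (T₀ s))) * (T' (-s) * (g * j (g₁ * i c))) := by
      rw [mul_assoc, S.braid.T_map_assoc, ← mul_assoc, ← map_mul, ← mul_assoc (T _),
        h.T_map, mul_assoc, h.T_g]
    have e₂ : j (i a * g₁) * (g * j (g₁ * i c)) * (j (T s) * T' (-s)) =
        j (i a * (g₁ * T (-s))) * (g * j (g₁ * (i c * T s))) := by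
      simp only [map_mul, mul_assoc]
      rw [← S.braid.T_map, ← S.braid.T_map_assoc, ← S.braid.T_map_assoc, S.braid.g_T_assoc]
    rw [e₁, e₂, σ_g_T F', F'.τ_g g rfl]
    congr 1
    simp only [mul_assoc]
    rw [← h.T_map, h.g_T_assoc s, h.T_map_assoc]

theorem σ_sandwich (S : FloorStep κ i T b G H j T' b' g H')
    (F : Floor κ z x y i τ T₀ b₀ T b G H) (F' : Floor κ z x y j σ T b T' b' {g} H')
    {θ : B →ₗ[K] K} {θ₀ : A →ₗ[K] K}
    (hθ : ∀ X, θ X = θ₀ (τ X)) (hcomm : ∀ X Y, θ (X * Y) = θ (Y * X))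
    (htw : ∀ g ∈ G, ∀ a, τ (twistSum i T₀ T * (g * (i a * g))) =
      τ (g * (i a * g) * twistSum i T₀ T)) (X Y : B) :
    θ (X * sandwich j g σ Y) = θ (sandwich j g σ X * Y) := by
  refine F.adjoint_eq hθ hcomm htw (fun a X => ?_) (fun a X => ?_) (fun β₀ β ξ hβ r => ?_)
    (fun g₁ hg₁ => ?_) X Y
  · simp only [sandwich_apply]
    rw [map_mul j, mul_assoc, S.g_map_assoc, F'.τ_map_mul]
  · simp only [sandwich_apply]
    rw [map_mul j, mul_assoc, ← S.g_map, ← mul_assoc (j X), ← mul_assoc, F'.τ_mul_map]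
  · obtain ⟨β', hβ'⟩ := hβ.lift b'
    have e₁ := F'.τ_decor hβ' 1 r
    rw [map_one, one_mul] at e₁
    have e₂ : ∀ s, σ (j (T s) * (g * j (T (r - s) * β))) = z • (T r * β) := by
      intro s
      rw [F'.τ_g g rfl, ← mul_assoc, ← F.T_add, add_sub_cancel]
    rw [sandwich_apply, S.braid.g_decor_g hβ', map_add, map_smul, map_sum, e₁,
      Finset.sum_congr rfl fun s _ => e₂ s, Finset.sum_const, Finset.card_univ,
      ← Nat.cast_smul_eq_nsmul K, smul_smul, smul_smul, mul_assoc]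
  · have e := S.g_braid_g hg₁ 1 1
    simp only [map_one, one_mul, mul_one] at e
    rw [sandwich_apply, e, F'.τ_g g rfl]

theorem σ_g_T_b (F' : Floor κ z x y j σ T b T' b' {g} H') (k m : R) :
    σ (g * (j (T k) * (T' m * b'))) = z • (T m * (b * T k)) +
      κ • ∑ s, (y (k - s) • T (m + s) - x (k - s) • (T (m + s) * b)) := by
  have h := F'.braid g rfl
  have e₁ : j (T m) * (T' k * (j b * g)) = j (T m * b) * (T' k * (g * j 1)) := by
    rw [h.T_map_assoc, map_one, mul_one, map_mul, mul_assoc]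
  have e₂ : ∀ s, j (T m) * (T' k * (j (T s) * T' (-s) * (b' - j b))) =
      j (T (m + s)) * (T' (k - s) * b') - j (T (m + s) * b) * T' (k - s) := by
    intro s
    rw [mul_assoc, h.T_map_assoc, ← mul_assoc (T' k), ← h.T_add, ← sub_eq_add_neg, mul_sub,
      h.T_map, mul_sub, mul_sub, h.T₀_add, map_mul, map_mul, map_mul]
    simp only [mul_assoc]
  have e₃ : g * (j (T k) * (T' m * b')) = j (T m) * (T' k * (g * b')) := by
    rw [← h.T_map_assoc, h.g_T_assoc, ← h.T_g_assoc]
  rw [e₃, h.g_b, mul_add, mul_add, map_add, e₁, σ_g_T F', mul_one, mul_assoc,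
    mul_smul_comm, mul_smul_comm, map_smul, twistSum, Finset.sum_mul, Finset.mul_sum,
    Finset.mul_sum, map_sum]
  congr 2
  refine Finset.sum_congr rfl fun s _ => ?_
  rw [e₂, map_sub, F'.τ_Tb, F'.τ_T]

theorem σ_g_T_b_b (F' : Floor κ z x y j σ T b T' b' {g} H') (k m : R) :
    σ (g * (j (T k * b) * (T' m * b'))) = z • (T m * (b * (T k * b))) := by
  have h := F'.braid g rfl
  have e : g * (j (T k * b) * (T' m * b')) = j (T m * b) * (T' k * (g * j b)) := by
    simp only [map_mul, mul_assoc]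
    rw [← h.T_map_assoc, ← h.T_map_assoc, h.g_T_assoc, ← h.T_g_assoc, h.g_b₀_b, h.T_map_assoc]
  rw [e, σ_g_T F', mul_assoc]

/-- The trace property for `g` against words `X t^m b`. -/
theorem trace_g_Tb (S : FloorStep κ i T b G H j T' b' g H')
    (F : Floor κ z x y i τ T₀ b₀ T b G H) (F' : Floor κ z x y j σ T b T' b' {g} H') (X : B)
    (m : R) : τ (σ (j X * (T' m * b') * g)) = τ (σ (g * (j X * (T' m * b')))) := by
  have h' := S.braid
  have e : ∀ X, σ (j X * (T' m * b') * g) = z • (X * (T m * b)) := by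
    intro X
    rw [mul_assoc, mul_assoc, h'.b_g, h'.T_g_assoc, ← map_mul, F'.τ_g g rfl]
  have key : ∀ w Q Z, b' * j Q = j Q * b' → 
      σ (g * (j (i w * (Z * Q)) * (T' m * b'))) = i w * σ (g * (j Z * (T' m * b'))) * Q := by
    intro w Q Z hQ
    rw [← F'.τ_map_mul, ← F'.τ_mul_map, ← S.g_map_assoc]
    simp only [map_mul, mul_assoc]
    rw [hQ, h'.T_map_assoc]
  rw [e]
  have hX : X ∈ (⊤ : Submodule K B) := trivial
  rw [← F.span_eq_top] at hX
  induction hX using Submodule.span_induction with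
  | mem X hX =>
    obtain ⟨a, k, rfl | rfl | ⟨g₁, hg₁, h, hh, rfl | rfl⟩⟩ := hX
    · have := key a 1 (T k) (by simp)
      rw [mul_one, mul_one] at this
      rw [this, σ_g_T_b F']
      have e₁ : ∑ s, (y (k - s) • x (m + s) • a - x (k - s) • y (m + s) • a) = 0 := by
        rw [Finset.sum_sub_distrib, sub_eq_zero]
        refine Fintype.sum_equiv (Equiv.subLeft (k - m)) _ _ fun s => ?_
        rw [Equiv.subLeft_apply, smul_comm]
        congr 2 <;> congr 1 <;> abel
      have e₂ : τ (i a * ∑ s, (y (k - s) • T (m + s) - x (k - s) • (T (m + s) * b))) = 0 := by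
        rw [← e₁, Finset.mul_sum, map_sum]
        refine Finset.sum_congr rfl fun s _ => ?_
        rw [mul_sub, mul_smul_comm, mul_smul_comm, map_sub, map_smul, map_smul, F.τ_T, F.τ_Tb]
      rw [mul_add, map_add, mul_smul_comm κ, map_smul τ κ, e₂, smul_zero, add_zero,
        mul_smul_comm, map_smul, map_smul]
      congr 2
      rw [← F.T_b, ← mul_assoc (T m), ← h'.T₀_add, mul_assoc, ← mul_assoc (T k), ← h'.T₀_add,
        add_comm]
    · have := key a 1 (T k * b) (by simp)
      rw [mul_one, mul_one] at this
      rw [this, σ_g_T_b_b F', mul_smul_comm, map_smul, map_smul]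
      congr 2
      rw [mul_assoc, mul_assoc, ← mul_assoc b, ← mul_assoc b, ← F.T_b, ← F.T_b,
        mul_assoc, mul_assoc, ← mul_assoc (T k), ← mul_assoc (T m), h'.T₀_comm]
    · have hB := F.braid g₁ hg₁
      have e₁ : ∀ s, i (T₀ m) * (T k * (i (T₀ s) * T (-s) * (b - i b₀) * i h)) =
          i (T₀ (m + s)) * (T (k - s) * (b * i h)) -
            i (T₀ (m + s)) * (T (k - s) * (1 * i (b₀ * h))) := by
        intro s
        rw [mul_assoc, mul_assoc, hB.T_map_assoc, ← mul_assoc (T k), ← F.T_add,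
          ← sub_eq_add_neg, ← mul_assoc, ← map_mul, ← hB.T₀_add, sub_mul, mul_sub, mul_sub,
          one_mul, map_mul]
      have e₂ : i a * (T k * (g₁ * i h)) * (T m * b) =
          i a * (i (T₀ m * b₀) * (g₁ * i (T₀ k * h)) +
            κ • ∑ s, i (T₀ m) * (T k * (i (T₀ s) * T (-s) * (b - i b₀) * i h))) := by
        have e₃ : T k * (g₁ * i h) * (T m * b) = i (T₀ m) * (T k * (g₁ * b * i h)) := by
          rw [mul_assoc, mul_assoc, mul_assoc, F.b_H h hh, ← hB.T_map_assoc, hB.g_T_assoc,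
            hB.T_map_assoc]
        rw [mul_assoc, e₃, hB.g_b, add_mul, mul_add, mul_add, ← Finset.mul_sum,
          ← Finset.mul_sum, ← Finset.sum_mul, ← Finset.sum_mul, smul_mul_assoc,
          mul_smul_comm, mul_smul_comm, mul_assoc (i b₀), hB.T_map_assoc, hB.T_g_assoc]
        simp only [map_mul, mul_assoc, twistSum]
      have e₃ : i a * (T m * (b * T k)) * (g₁ * i h) =
          i a * (g₁ * i (T₀ m * (b₀ * (T₀ k * h)))) := by
        simp only [mul_assoc, map_mul]
        rw [hB.T_g_assoc, hB.b_g_assoc, hB.T_g_assoc]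
      have e₄ : ∀ s, τ (i (T₀ m) * (T k * (i (T₀ s) * T (-s) * (b - i b₀) * i h))) =
          y (k - s) • (T₀ (m + s) * h) - x (k - s) • (T₀ (m + s) * (b₀ * h)) := by
        intro s
        rw [e₁, map_sub, F.τ_map_mul, F.τ_map_mul, F.τ_decor_map .loop, F.τ_decor_map .one,
          mul_smul_comm, mul_smul_comm]
      have e₅ : ∀ s, τ ((y (k - s) • T (m + s) - x (k - s) • (T (m + s) * b)) * (g₁ * i h)) =
          z • (y (k - s) • (T₀ (m + s) * h) - x (k - s) • (T₀ (m + s) * (b₀ * h))) := by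
        intro s
        have e₆ := F.τ_g g₁ hg₁ 1
        simp only [map_one, one_mul] at e₆
        rw [sub_mul, smul_mul_assoc, smul_mul_assoc, mul_assoc, hB.b_g_assoc, hB.T_g_assoc,
          hB.T_g_assoc, ← map_mul, ← map_mul, ← map_mul, map_sub, map_smul, map_smul, e₆, e₆,
          smul_sub, smul_comm z, smul_comm z]
      rw [key a (g₁ * i h) (T k) (S.b_H _ (S.mul_mem g₁ hg₁ h hh)), σ_g_T_b F', mul_add,
        add_mul, map_add, mul_smul_comm, mul_smul_comm, smul_mul_assoc, smul_mul_assoc, map_smul,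
        e₃, map_smul τ z (i a * (g₁ * _)), F.τ_g g₁ hg₁, map_smul τ κ, mul_assoc (i a) (Finset.sum _ _),
        F.τ_map_mul,
        Finset.sum_mul, map_sum, Finset.sum_congr rfl fun s _ => e₅ s, e₂, F.τ_map_mul, map_add, F.τ_g g₁ hg₁,
        map_smul τ κ, map_sum, Finset.sum_congr rfl fun s _ => e₄ s, ← Finset.smul_sum, mul_add,
        smul_add, mul_smul_comm, mul_smul_comm, mul_smul_comm, smul_comm κ z]
      simp only [mul_assoc]
    · have hB := F.braid g₁ hg₁
      have e₁ : i a * (T k * (b * (g₁ * i h))) * (T m * b) =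
          i (a * (T₀ m * b₀)) * (g₁ * i (T₀ k * (b₀ * h))) := by
        simp only [mul_assoc, map_mul]
        have e : g₁ * (i b₀ * (b * i h)) = i b₀ * (g₁ * (i b₀ * i h)) := by
          rw [← mul_assoc (i b₀) b, ← mul_assoc g₁, hB.g_b₀_b]
          simp only [mul_assoc]
        rw [hB.b_g_assoc, hB.T_g_assoc, ← hB.T_map_assoc m h, ← F.b_H h hh,
          ← hB.T_map_assoc m b₀, ← hB.T_map_assoc m, hB.g_T_assoc, ← hB.T_g_assoc, e,
          hB.T_map_assoc, hB.T_g_assoc]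
      have e₂ : i a * (T m * (b * (T k * b))) * (g₁ * i h) =
          i a * (g₁ * i (T₀ m * (b₀ * (T₀ k * (b₀ * h))))) := by
        simp only [mul_assoc, map_mul]
        rw [hB.b_g_assoc, hB.T_g_assoc, hB.b_g_assoc, hB.T_g_assoc]
      rw [← mul_assoc (T k), key a (g₁ * i h) (T k * b) (S.b_H _ (S.mul_mem g₁ hg₁ h hh)),
        σ_g_T_b_b F', mul_smul_comm, smul_mul_assoc, map_smul, map_smul, e₂, mul_assoc (T k), e₁,
        F.τ_g g₁ hg₁, F.τ_g g₁ hg₁]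
      simp only [mul_assoc]
  | zero => simp
  | add X Y _ _ hX hY => simp only [add_mul, smul_add, map_add, hX, hY, mul_add]
  | smul k X _ hX =>
    rw [smul_mul_assoc, smul_comm, map_smul τ k, hX]
    simp only [map_smul, smul_mul_assoc, mul_smul_comm]

theorem trace_g (S : FloorStep κ i T b G H j T' b' g H')
    (F : Floor κ z x y i τ T₀ b₀ T b G H) (F' : Floor κ z x y j σ T b T' b' {g} H')
    {θ : B →ₗ[K] K} {θ₀ : A →ₗ[K] K}
    (hθ : ∀ X, θ X = θ₀ (τ X)) (hcomm : ∀ X Y, θ (X * Y) = θ (Y * X))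
    (htw : ∀ g ∈ G, ∀ a, τ (twistSum i T₀ T * (g * (i a * g))) =
      τ (g * (i a * g) * twistSum i T₀ T)) (Z : D) : θ (σ (Z * g)) = θ (σ (g * Z)) := by
  have hZ : Z ∈ wordSpan j T' b' g := by rw [S.wordSpan_eq_top F]; trivial
  induction hZ using wordSpan_induction with
  | zero => simp
  | add X Y _ _ hX hY => simp only [add_mul, mul_add, map_add, hX, hY]
  | smul k X _ hX => simp only [smul_mul_assoc, mul_smul_comm, map_smul, hX]
  | hT X r =>
    have e₁ : j X * T' r * g = j X * (g * j (T r)) := by rw [mul_assoc, S.braid.T_g]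
    have e₂ : g * (j X * T' r) = j (T r) * (g * j X) := by
      rw [← S.braid.T_map, S.braid.g_T_assoc]
    rw [e₁, e₂, F'.τ_g g rfl, F'.τ_g g rfl, map_smul, map_smul, hcomm]
  | hb X r => rw [hθ, hθ, S.trace_g_Tb F F']
  | hg X Y =>
    rw [← mul_assoc (j X), ← mul_assoc g, mul_assoc (j X * g), F'.τ_mul_map, ← sandwich_apply,
      ← S.σ_sandwich F F' hθ hcomm htw, mul_assoc, F'.τ_map_mul, sandwich_apply]

theorem trace_T (S : FloorStep κ i T b G H j T' b' g H')
    (F : Floor κ z x y i τ T₀ b₀ T b G H) (F' : Floor κ z x y j σ T b T' b' {g} H') (Z : D)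
    (r : R) : σ (Z * T' r) = σ (T' r * Z) := by
  have hZ : Z ∈ wordSpan j T' b' g := by rw [S.wordSpan_eq_top F]; trivial
  induction hZ using wordSpan_induction with
  | zero => simp
  | add X Y _ _ hX hY => simp only [add_mul, mul_add, map_add, hX, hY]
  | smul k X _ hX => simp only [smul_mul_assoc, mul_smul_comm, map_smul, hX]
  | hT X s => rw [S.braid.T_map_assoc, mul_assoc, S.braid.T_comm]
  | hb X s =>
    rw [S.braid.T_map_assoc, mul_assoc, mul_assoc, ← S.braid.T_b, ← mul_assoc (T' s),
      S.braid.T_comm, mul_assoc]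
  | hg X Y =>
    rw [S.braid.T_map_assoc, S.braid.T_g_assoc, mul_assoc, mul_assoc, ← S.braid.T_map,
      S.braid.g_T_assoc, ← map_mul, ← mul_assoc, ← map_mul, F'.τ_g g rfl, F'.τ_g g rfl, mul_assoc]

/-- The trace property passes to the next floor of the tower. -/
theorem trace_comm (S : FloorStep κ i T b G H j T' b' g H')
    (F : Floor κ z x y i τ T₀ b₀ T b G H) (F' : Floor κ z x y j σ T b T' b' {g} H')
    {θ : B →ₗ[K] K} {θ₀ : A →ₗ[K] K}
    (hθ : ∀ X, θ X = θ₀ (τ X)) (hcomm : ∀ X Y, θ (X * Y) = θ (Y * X))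
    (htw : ∀ g ∈ G, ∀ a, τ (twistSum i T₀ T * (g * (i a * g))) =
      τ (g * (i a * g) * twistSum i T₀ T)) (Z W : D) : θ (σ (Z * W)) = θ (σ (W * Z)) := by
  have hW : W ∈ Algebra.adjoin K (Set.range j ∪ ({g} ∪ Set.range T')) := by
    rw [S.adjoin_eq_top]; trivial
  induction hW using Algebra.adjoin_induction generalizing Z with
  | mem W hW =>
    obtain ⟨Y, rfl⟩ | rfl | ⟨r, rfl⟩ := hW
    · rw [F'.τ_mul_map, F'.τ_map_mul, hcomm]
    · exact S.trace_g F F' hθ hcomm htw Z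
    · rw [S.trace_T F F']
  | algebraMap k => rw [Algebra.commutes]
  | add X Y _ _ hX hY => simp only [add_mul, mul_add, map_add, hX, hY]
  | mul X Y _ _ hX hY => rw [← mul_assoc, hY, ← mul_assoc, hX, mul_assoc]

end FloorStep

end Tower

section Tower

variable {K R A B D : Type*} [Field K] [AddCommGroup R] [Fintype R]
  [Ring A] [Algebra K A] [Ring B] [Algebra K B] [Ring D] [Algebra K D]

namespace BraidStep

variable {κ : K} {j : B →ₐ[K] D} {T : R → B} {b : B} {T' : R → D} {b' g : D}

/-- The commutator of the two loop generators lies in the slide span. -/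
theorem loop_comm_mem (h : BraidStep κ j T b T' b' g) (r : R) :
    T' r * (b' * j b) - j b * (T' r * b') ∈ slideSpan j {g} := by
  have e : ∀ s, T' r * (j b * (g * (j b * (j (T s) * T' (-s))))) -
      T' r * (g * (j b * (j (T s) * T' (-s) * j b))) =
      j (b * T (-s)) * (g * j (b * T (r + s))) - j (T (-s)) * (g * j (b * (T (r + s) * b))) := by
    intro s
    have e₁ : T' r * (j b * (g * (j b * (j (T s) * T' (-s))))) =
        j (b * T (-s)) * (g * j (b * T (r + s))) := by
      rw [h.T_map_assoc, h.T_g_assoc, ← h.T_map, ← h.T_map_assoc (-s) b, ← h.T_map_assoc (-s),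
        h.g_T_assoc, h.T₀_add, ← mul_assoc b, ← h.T₀_b₀ r]
      simp only [map_mul, mul_assoc]
    have e₂ : T' r * (g * (j b * (j (T s) * T' (-s) * j b))) =
        j (T (-s)) * (g * j (b * (T (r + s) * b))) := by
      rw [h.T_g_assoc, ← h.T_map, mul_assoc, ← h.T_map_assoc (-s) b, ← h.T_map_assoc (-s),
        h.g_T_assoc, h.T₀_add, mul_assoc, ← mul_assoc b, ← h.T₀_b₀ r]
      simp only [map_mul, mul_assoc]
    rw [e₁, e₂]
  have e' : T' r * (b' * j b) - j b * (T' r * b') =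
      κ • ∑ s, (j (b * T (-s)) * (g * j (b * T (r + s))) -
        j (T (-s)) * (g * j (b * (T (r + s) * b)))) := by
    rw [← Finset.sum_congr rfl fun s _ => e s, Finset.sum_sub_distrib, ← Finset.mul_sum,
      ← Finset.mul_sum, ← Finset.mul_sum, ← Finset.mul_sum, ← Finset.mul_sum, ← Finset.mul_sum,
      ← Finset.mul_sum, ← Finset.sum_mul, ← h.T_map_assoc, ← mul_sub, ← mul_sub, ← mul_smul_comm]
    congr 1
    have q := h.quad
    rw [h.b_eq]
    simp only [mul_sub, sub_mul, mul_smul_comm, smul_mul_assoc, smul_sub, mul_assoc, q]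
    rw [twistSum]
    abel
  rw [e']
  refine Submodule.smul_mem _ _ (sum_mem fun s _ => Submodule.subset_span
    ⟨g, rfl, _, _, _, _, ?_, rfl⟩)
  rw [← h.T₀_b₀ (-s), h.T₀_b₀ (r + s), mul_assoc]

theorem b_map_of_adjoin {s : Set B}
    (hs : Algebra.adjoin K s = ⊤)
    (hb : ∀ X ∈ s, ∀ r, T' r * (b' * j X) - j X * (T' r * b') ∈ slideSpan j {g}) (r : R) (X : B) :
    T' r * (b' * j X) - j X * (T' r * b') ∈ slideSpan j {g} := by
  have hX : X ∈ Algebra.adjoin K s := by rw [hs]; trivial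
  induction hX using Algebra.adjoin_induction with
  | mem X hX => exact hb X hX r
  | algebraMap k =>
    rw [AlgHom.commutes, ← Algebra.commutes, Algebra.left_comm, sub_self]
    exact zero_mem _
  | add X Y _ _ hX hY =>
    have := add_mem hX hY
    rw [map_add, mul_add, mul_add, add_mul]
    rwa [add_sub_add_comm]
  | mul X Y _ _ hX hY =>
    have := add_mem (mul_map_mem_slideSpan hX Y) (map_mul_mem_slideSpan hY X)
    have e : T' r * (b' * j (X * Y)) - j (X * Y) * (T' r * b') =
        (T' r * (b' * j X) - j X * (T' r * b')) * j Y +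
          j X * (T' r * (b' * j Y) - j Y * (T' r * b')) := by
      simp only [map_mul, sub_mul, mul_sub, mul_assoc]
      abel
    rwa [e]

/-- Conjugation by `g` maps slide spans to slide spans. -/
theorem conj_mem_slideSpan {i : A →ₐ[K] B} {G : Set B} (h : BraidStep κ j T b T' b' g)
    (g_map : ∀ a, g * j (i a) = j (i a) * g)
    (braid_rel : ∀ g₁ ∈ G, g * (j g₁ * g) = j g₁ * (g * j g₁))
    (inv : ∀ g₁ ∈ G, ∃ g₂, g₁ * g₂ = 1 ∧ g₂ * g₁ = 1) {X : B} (hX : X ∈ slideSpan i G) :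
    g * (j X * (g - κ • twistSum j T T')) ∈ slideSpan j {g} := by
  induction hX using Submodule.span_induction with
  | mem X hX =>
    obtain ⟨g₁, hg₁, a, a', c, c', hac, rfl⟩ := hX
    obtain ⟨g₂, h₁, h₂⟩ := inv g₁ hg₁
    have e : ∀ a a', g * (j (i a * (g₁ * i a')) * (g - κ • twistSum j T T')) =
        j (i a * g₂) * (g * j (g₁ * i a')) := by
      intro a a'
      have e₁ : g * (j (i a * (g₁ * i a')) * (g - κ • twistSum j T T')) * g =
          j (i a * g₂) * (g * j (g₁ * i a')) * g := by
        simp only [mul_assoc]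
        rw [h.inv_mul_g, mul_one]
        simp only [map_mul, mul_assoc]
        rw [← g_map a', ← mul_assoc (j g₁) g, ← mul_assoc g (j g₁ * g), braid_rel g₁ hg₁,
          mul_assoc, ← mul_assoc (j g₂) (j g₁), ← map_mul j g₂, h₂, map_one, one_mul, ← mul_assoc g,
          g_map, mul_assoc, mul_assoc]
      have e₂ := congrArg (· * (g - κ • twistSum j T T')) e₁
      simpa only [mul_assoc, h.g_mul_inv, mul_one] using e₂
    rw [map_sub, sub_mul, mul_sub, e, e]
    refine Submodule.subset_span ⟨g, rfl, _, _, _, _, ?_, rfl⟩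
    rw [mul_assoc, ← mul_assoc g₂, h₂, one_mul, ← map_mul, mul_assoc, ← mul_assoc g₂, h₂, one_mul,
      ← map_mul, hac]
  | zero => simp
  | add X Y _ _ hX hY => rw [map_add, add_mul, mul_add]; exact add_mem hX hY
  | smul k X _ hX =>
    rw [map_smul, smul_mul_assoc, mul_smul_comm]; exact Submodule.smul_mem _ _ hX

theorem b_map_map {i : A →ₐ[K] B} {G : Set B} (h : BraidStep κ j T b T' b' g)
    (g_map : ∀ a, g * j (i a) = j (i a) * g)
    (braid_rel : ∀ g₁ ∈ G, g * (j g₁ * g) = j g₁ * (g * j g₁))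
    (inv : ∀ g₁ ∈ G, ∃ g₂, g₁ * g₂ = 1 ∧ g₂ * g₁ = 1)
    (b_map : ∀ r a, T r * (b * i a) - i a * (T r * b) ∈ slideSpan i G) (r : R) (a : A) :
    T' r * (b' * j (i a)) - j (i a) * (T' r * b') ∈ slideSpan j {g} := by
  have := h.conj_mem_slideSpan g_map braid_rel inv (b_map r a)
  convert this using 1
  have e : (g - κ • twistSum j T T') * j (i a) = j (i a) * (g - κ • twistSum j T T') := by
    have e₁ := congrArg (fun X => (g - κ • twistSum j T T') * (X * (g - κ • twistSum j T T')))
      (g_map a)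
    simp only [mul_assoc, h.g_mul_inv, mul_one] at e₁
    rw [← mul_assoc _ g, h.inv_mul_g, one_mul] at e₁
    exact e₁.symm
  rw [h.b_eq]
  generalize g - κ • twistSum j T T' = gi at e ⊢
  simp only [map_sub, map_mul, sub_mul, mul_sub, mul_assoc, e]
  rw [← mul_assoc g (j (i a)), g_map]
  simp only [mul_assoc, h.T_g_assoc]

end BraidStep

end Tower

section Relations

variable {d n : ℕ}

theorem mkY_eq {p q : FA n} (h : YBrel d n p q) : mkY d n p = mkY d n q :=
  RingQuot.mkAlgHom_rel Kf h

theorem gY_commute {i j : ℕ} (hi : 1 ≤ i) (hin : i ≤ n - 1) (hj : 1 ≤ j) (hjn : j ≤ n - 1)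
    (h : i + 1 < j ∨ j + 1 < i) : Commute (gY d n i) (gY d n j) := by
  have := mkY_eq (YBrel.gg (d := d) i j hi hin hj hjn h)
  rwa [map_mul, map_mul] at this

theorem gY_braid {i : ℕ} (hi : 1 ≤ i) (hin : i + 2 ≤ n) :
    gY d n i * (gY d n (i + 1) * gY d n i) = gY d n (i + 1) * (gY d n i * gY d n (i + 1)) := by
  have := mkY_eq (YBrel.braid (d := d) (n := n) i hi (by omega))
  simp only [map_mul, mul_assoc] at this
  exact this

theorem bY_gY_commute {i : ℕ} (hi : 2 ≤ i) (hin : i ≤ n - 1) :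
    Commute (bY d n) (gY d n i) := by
  have := mkY_eq (YBrel.bg (d := d) i hi hin)
  rwa [map_mul, map_mul] at this

theorem bY_gY_quad : gY d n 1 * (bY d n * (gY d n 1 * bY d n)) =
    bY d n * (gY d n 1 * (bY d n * gY d n 1)) := by
  have := mkY_eq (YBrel.bgbg (d := d) (n := n))
  simp only [map_mul, mul_assoc] at this
  exact this.symm

theorem tY_commute {i j : ℕ} (hi : 1 ≤ i) (hin : i ≤ n) (hj : 1 ≤ j) (hjn : j ≤ n) :
    Commute (tY d n i) (tY d n j) := by
  have := mkY_eq (YBrel.tt (d := d) i j hi hin hj hjn)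
  rwa [map_mul, map_mul] at this

theorem tY_gY {i j : ℕ} (hi : 1 ≤ i) (hin : i ≤ n - 1) (hj : 1 ≤ j) (hjn : j ≤ n) :
    tY d n j * gY d n i = gY d n i * tY d n (sAct i j) := by
  have := mkY_eq (YBrel.tg (d := d) i j hi hin hj hjn)
  rwa [map_mul, map_mul] at this

theorem tY_bY_commute {i : ℕ} (hi : 1 ≤ i) (hin : i ≤ n) : Commute (tY d n i) (bY d n) := by
  have := mkY_eq (YBrel.tb (d := d) i hi hin)
  rwa [map_mul, map_mul] at this

theorem tY_pow {i : ℕ} (hi : 1 ≤ i) (hin : i ≤ n) : tY d n i ^ d = 1 := by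
  have := mkY_eq (YBrel.td (d := d) i hi hin)
  rwa [map_pow, map_one] at this

theorem gY_sq {i : ℕ} (hi : 1 ≤ i) (hin : i ≤ n - 1) :
    gY d n i * gY d n i = 1 + (uu - uu⁻¹) • (eY d n i * gY d n i) := by
  have := mkY_eq (YBrel.gsq (d := d) i hi hin)
  rwa [map_pow, map_add, map_one, map_smul, map_mul, pow_two] at this

theorem bY_sq : bY d n * bY d n = 1 + (vv - vv⁻¹) • (fY d n * bY d n) := by
  have := mkY_eq (YBrel.bsq (d := d) (n := n))
  rwa [map_pow, map_add, map_one, map_smul, map_mul, pow_two] at this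

/-- The generators of `Y_{d,n}^B`. -/
def gens (d n : ℕ) : Set (YB d n) :=
  {X | X = bY d n ∨ (∃ i, 1 ≤ i ∧ i ≤ n - 1 ∧ X = gY d n i) ∨ ∃ j, 1 ≤ j ∧ j ≤ n ∧ X = tY d n j}

theorem adjoin_gens (d n : ℕ) : Algebra.adjoin Kf (gens d n) = ⊤ := by
  refine Algebra.eq_top_iff.2 fun X => ?_
  obtain ⟨p, rfl⟩ := RingQuot.mkAlgHom_surjective Kf (YBrel d n) X
  change mkY d n p ∈ _
  induction p using FreeAlgebra.induction with
  | grade0 k => rw [AlgHom.commutes]; exact Subalgebra.algebraMap_mem _ _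
  | grade1 s =>
    refine Algebra.subset_adjoin ?_
    rcases s with _ | i | j
    · exact .inl rfl
    · refine .inr (.inl ⟨i + 1, by omega, by omega, ?_⟩)
      rw [gY, Gg, dif_pos ⟨by omega, by omega⟩]
      rfl
    · refine .inr (.inr ⟨j + 1, by omega, by omega, ?_⟩)
      rw [tY, Tt, dif_pos ⟨by omega, by omega⟩]
      rfl
  | mul p q hp hq => rw [map_mul]; exact mul_mem hp hq
  | add p q hp hq => rw [map_add]; exact add_mem hp hq

/-- Powers of the framing generators with exponents in `ℤ / d`. -/
def tZ (d n k : ℕ) (r : ZMod d) : YB d n := tY d n k ^ r.val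

theorem tZ_zero (k : ℕ) : tZ d n k 0 = 1 := by rw [tZ, ZMod.val_zero, pow_zero]

theorem tZ_natCast {k : ℕ} (hk : 1 ≤ k) (hkn : k ≤ n) (m : ℕ) :
    tZ d n k (m : ZMod d) = tY d n k ^ m := by
  rw [tZ, ZMod.val_natCast]
  conv_rhs => rw [← Nat.mod_add_div m d, pow_add, pow_mul, tY_pow hk hkn, one_pow, mul_one]

theorem tZ_add [NeZero d] {k : ℕ} (hk : 1 ≤ k) (hkn : k ≤ n) (r s : ZMod d) :
    tZ d n k (r + s) = tZ d n k r * tZ d n k s := by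
  have : r + s = ((r.val + s.val : ℕ) : ZMod d) := by simp
  rw [this, tZ_natCast hk hkn, pow_add, tZ, tZ]

theorem commute_tZ {X : YB d n} {k : ℕ} (h : Commute (tY d n k) X) (r : ZMod d) :
    Commute (tZ d n k r) X := h.pow_left _

theorem tZ_commute {i j : ℕ} (hi : 1 ≤ i) (hin : i ≤ n) (hj : 1 ≤ j) (hjn : j ≤ n)
    (r s : ZMod d) : Commute (tZ d n i r) (tZ d n j s) :=
  (tY_commute hi hin hj hjn).pow_pow _ _

theorem tZ_gY {i j : ℕ} (hi : 1 ≤ i) (hin : i ≤ n - 1) (hj : 1 ≤ j) (hjn : j ≤ n)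
    (r : ZMod d) : tZ d n j r * gY d n i = gY d n i * tZ d n (sAct i j) r :=
  (SemiconjBy.pow_right (show SemiconjBy (gY d n i) (tY d n (sAct i j)) (tY d n j) from
    (tY_gY hi hin hj hjn).symm) r.val).symm

theorem eY_eq [NeZero d] {i : ℕ} (hi : 1 ≤ i) (hin : i ≤ n - 1) :
    eY d n i = (d : Kf)⁻¹ • ∑ r : ZMod d, tZ d n i r * tZ d n (i + 1) (-r) := by
  rw [eY, eF, map_smul, map_sum]
  congr 1
  refine Finset.sum_bij' (fun m _ => (m : ZMod d)) (fun r _ => r.val) (fun _ _ => Finset.mem_univ _)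
    (fun r _ => Finset.mem_range.2 r.val_lt) (fun m hm => ?_) (fun r _ => ?_) (fun m hm => ?_)
  · exact ZMod.val_cast_of_lt (Finset.mem_range.1 hm)
  · exact ZMod.natCast_zmod_val r
  · have : -(m : ZMod d) = ((d - m : ℕ) : ZMod d) := by
      rw [Nat.cast_sub (Finset.mem_range.1 hm).le, ZMod.natCast_self, zero_sub]
    rw [this, tZ_natCast hi (by omega), tZ_natCast (by omega) (by omega), map_mul, map_pow, map_pow]
    rfl

/-- The coefficient of the unnormalised sum in the quadratic relation. -/
def kap (d : ℕ) : Kf := (uu - uu⁻¹) * (d : Kf)⁻¹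

theorem smul_eY [NeZero d] {i : ℕ} (hi : 1 ≤ i) (hin : i ≤ n - 1) :
    (uu - uu⁻¹) • eY d n i = kap d • ∑ r : ZMod d, tZ d n i r * tZ d n (i + 1) (-r) := by
  rw [eY_eq hi hin, smul_smul, kap]

end Relations

section Inverse

theorem SemiconjBy.of_mul_eq_one {M : Type*} [Monoid M] {a c x y : M} (h : SemiconjBy a x y)
    (hac : a * c = 1) (hca : c * a = 1) : SemiconjBy c y x :=
  SemiconjBy.units_inv_symm_left (a := ⟨a, c, hac, hca⟩) h

variable {d n : ℕ}

theorem sAct_self (i : ℕ) : sAct i i = i + 1 := by simp [sAct]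

theorem sAct_succ (i : ℕ) : sAct i (i + 1) = i := by simp [sAct]

theorem sAct_of_ne {i j : ℕ} (h : j ≠ i) (h' : j ≠ i + 1) : sAct i j = j := by simp [sAct, h, h']

theorem one_le_sAct {i j : ℕ} (hi : 1 ≤ i) (hj : 1 ≤ j) : 1 ≤ sAct i j := by
  unfold sAct; split_ifs <;> omega

theorem sAct_le {i j : ℕ} (hin : i ≤ n - 1) (hi : 1 ≤ i) (hj : j ≤ n) : sAct i j ≤ n := by
  unfold sAct; split_ifs <;> omega

theorem gInv_mul_gY {i : ℕ} (hi : 1 ≤ i) (hin : i ≤ n - 1) : gInv d n i * gY d n i = 1 := by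
  rw [gInv, sub_mul, gY_sq hi hin, smul_mul_assoc, add_sub_cancel_right]

theorem bk_succ {k : ℕ} (hk : 1 ≤ k) :
    bk d n (k + 1) = gY d n k * bk d n k * gInv d n k := by
  obtain ⟨k, rfl⟩ := Nat.exists_eq_add_of_le' hk
  rfl

theorem bk_succ_mul_gY {k : ℕ} (hk : 1 ≤ k) (hkn : k ≤ n - 1) :
    bk d n (k + 1) * gY d n k = gY d n k * bk d n k := by
  rw [bk_succ hk, mul_assoc, gInv_mul_gY hk hkn, mul_one]

variable [NeZero d]

theorem gInv_eq {i : ℕ} (hi : 1 ≤ i) (hin : i ≤ n - 1) :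
    gInv d n i = gY d n i - kap d • ∑ r : ZMod d, tZ d n i r * tZ d n (i + 1) (-r) := by
  rw [gInv, smul_eY hi hin]

theorem eY_gY_commute {i : ℕ} (hi : 1 ≤ i) (hin : i ≤ n - 1) : Commute (eY d n i) (gY d n i) := by
  rw [eY_eq hi hin]
  refine Commute.smul_left ?_ _
  rw [Commute, SemiconjBy, Finset.sum_mul, Finset.mul_sum, ← Equiv.sum_comp (Equiv.neg (ZMod d))]
  refine Finset.sum_congr rfl fun r _ => ?_
  rw [Equiv.neg_apply, neg_neg, mul_assoc, tZ_gY hi hin (by omega) (by omega), sAct_succ,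
    ← mul_assoc, tZ_gY hi hin hi (by omega), sAct_self, mul_assoc,
    (tZ_commute (by omega) (by omega) (by omega) (by omega) _ _).eq]

theorem gY_mul_gInv {i : ℕ} (hi : 1 ≤ i) (hin : i ≤ n - 1) : gY d n i * gInv d n i = 1 := by
  rw [gInv, mul_sub, gY_sq hi hin, mul_smul_comm, (eY_gY_commute hi hin).eq, add_sub_cancel_right]

theorem semiconjBy_gInv {i : ℕ} (hi : 1 ≤ i) (hin : i ≤ n - 1) {X Y : YB d n}
    (h : SemiconjBy (gY d n i) X Y) : SemiconjBy (gInv d n i) Y X :=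
  h.of_mul_eq_one (gY_mul_gInv hi hin) (gInv_mul_gY hi hin)

theorem commute_gInv {i : ℕ} (hi : 1 ≤ i) (hin : i ≤ n - 1) {X : YB d n}
    (h : Commute (gY d n i) X) : Commute (gInv d n i) X := semiconjBy_gInv hi hin h

theorem tY_bk_commute {k : ℕ} (hk : 1 ≤ k) : ∀ {j : ℕ}, k ≤ n → 1 ≤ j → j ≤ n →
    Commute (tY d n j) (bk d n k) := by
  induction k, hk using Nat.le_induction with
  | base => exact fun _ hj hjn => tY_bY_commute hj hjn
  | succ k hk ih =>
    intro j hkn hj hjn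
    rw [bk_succ hk]
    have h : SemiconjBy (gY d n k) (tY d n (sAct k j)) (tY d n j) :=
      (tY_gY hk (by omega) hj hjn).symm
    exact ((h.mul_left (ih (by omega) (one_le_sAct hk hj)
      (sAct_le (by omega) hk hjn)).symm).mul_left (semiconjBy_gInv hk (by omega) h)).symm

theorem gY_bk_commute_of_lt {k : ℕ} (hk : 1 ≤ k) : ∀ {i : ℕ}, k < i → i ≤ n - 1 →
    Commute (gY d n i) (bk d n k) := by
  induction k, hk using Nat.le_induction with
  | base => exact fun hi hin => (bY_gY_commute hi hin).symm
  | succ k hk ih =>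
    intro i hi hin
    rw [bk_succ hk]
    have h := gY_commute (d := d) hk (by omega) (by omega) hin (.inl hi)
    exact (h.symm.mul_right (ih (by omega) hin)).mul_right (commute_gInv hk (by omega) h).symm

theorem gY_bk_add_two_commute {i : ℕ} (hi : 1 ≤ i) (hin : i + 2 ≤ n) :
    Commute (gY d n i) (bk d n (i + 2)) := by
  have h₁ : SemiconjBy (gY d n (i + 1) * gY d n i) (gY d n (i + 1)) (gY d n i) := by
    rw [SemiconjBy, mul_assoc, ← gY_braid hi hin]
  have h₂ : SemiconjBy (gInv d n i * gInv d n (i + 1)) (gY d n i) (gY d n (i + 1)) := by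
    refine h₁.of_mul_eq_one ?_ ?_
    · rw [mul_assoc, ← mul_assoc (gY d n i), gY_mul_gInv hi (by omega), one_mul,
        gY_mul_gInv (by omega) (by omega)]
    · rw [mul_assoc, ← mul_assoc (gInv d n (i + 1)), gInv_mul_gY (by omega) (by omega), one_mul,
        gInv_mul_gY hi (by omega)]
  have : bk d n (i + 2) =
      gY d n (i + 1) * gY d n i * bk d n i * (gInv d n i * gInv d n (i + 1)) := by
    rw [bk_succ (k := i + 1) (by omega), bk_succ hi]
    simp only [mul_assoc]
  rw [this]
  have h₃ := gY_bk_commute_of_lt (d := d) (n := n) hi (Nat.lt_succ_self i) (by omega)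
  exact (SemiconjBy.mul_left (SemiconjBy.mul_left h₁ h₃.symm) h₂).symm

theorem gY_bk_commute_of_add_two_le {i k : ℕ} (hi : 1 ≤ i) (hik : i + 2 ≤ k) : k ≤ n →
    Commute (gY d n i) (bk d n k) := by
  induction k, hik using Nat.le_induction with
  | base => exact gY_bk_add_two_commute hi
  | succ k hk ih =>
    intro hkn
    rw [bk_succ (by omega)]
    have h := gY_commute (d := d) hi (by omega) (by omega) (show k ≤ n - 1 by omega)
      (.inl (by omega))
    exact (h.mul_right (ih (by omega))).mul_right (commute_gInv (by omega) (by omega) h.symm).symm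

theorem gY_bk_quad {k : ℕ} (hk : 1 ≤ k) : k ≤ n - 1 →
    gY d n k * (bk d n k * (gY d n k * bk d n k)) =
      bk d n k * (gY d n k * (bk d n k * gY d n k)) := by
  induction k, hk using Nat.le_induction with
  | base => exact fun _ => bY_gY_quad
  | succ k hk ih =>
    intro hkn
    have hg : SemiconjBy (gY d n k * gY d n (k + 1)) (gY d n k) (gY d n (k + 1)) := by
      rw [SemiconjBy, mul_assoc, gY_braid hk (by omega)]
    have hb : SemiconjBy (gY d n k * gY d n (k + 1)) (bk d n k) (bk d n (k + 1)) := by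
      refine SemiconjBy.mul_left (y := bk d n k) ?_
        (gY_bk_commute_of_lt hk (Nat.lt_succ_self k) hkn)
      exact (bk_succ_mul_gY hk (by omega)).symm
    have hX : (gY d n k * gY d n (k + 1)) * (gInv d n (k + 1) * gInv d n k) = 1 := by
      rw [mul_assoc, ← mul_assoc (gY d n (k + 1)), gY_mul_gInv (by omega) hkn, one_mul,
        gY_mul_gInv hk (by omega)]
    have h₁ := hg.mul_right (hb.mul_right (hg.mul_right hb))
    have h₂ := hb.mul_right (hg.mul_right (hb.mul_right hg))
    rw [← ih (by omega)] at h₂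
    have h := congrArg (· * (gInv d n (k + 1) * gInv d n k)) (h₁.eq.symm.trans h₂.eq)
    simp only [mul_assoc] at h hX
    simpa only [hX, mul_one] using h

end Inverse

section Spanning

variable {d n : ℕ}

theorem gRange_succ {j k : ℕ} (hjk : j ≤ k) :
    gRange d n j (k + 1) = gY d n k * gRange d n j k := by
  rw [gRange, Nat.sub_add_comm hjk, List.range'_concat, List.reverse_append, List.map_append,
    List.prod_append, gRange]
  simp [Nat.add_sub_cancel' hjk]

theorem gRange_self (j : ℕ) : gRange d n j j = 1 := by simp [gRange]

theorem mPlus_succ {j k m : ℕ} (hjk : j ≤ k) :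
    mPlus d n (k + 1) j m = gY d n k * mPlus d n k j m := by
  rw [mPlus, mPlus, if_neg (by omega), gRange_succ hjk]
  split_ifs with h
  · rw [h, gRange_self, mul_one]
  · rw [mul_assoc]

variable [NeZero d]

theorem mMinus_succ {j k m : ℕ} (hj : 1 ≤ j) (hjk : j ≤ k) (hkn : k ≤ n) :
    mMinus d n (k + 1) j m = gY d n k * mMinus d n k j m := by
  rw [mMinus, mMinus, if_neg (by omega), gRange_succ hjk]
  split_ifs with h
  · rw [h, gRange_self, mul_one]
    subst h
    rw [((tY_bk_commute (d := d) hj hkn hj hkn).pow_left m).eq]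
  · rw [mul_assoc]

theorem exists_eq_of_mem_Mset {k : ℕ} (hk : 1 ≤ k) : ∀ {c : YB d n}, k ≤ n → c ∈ Mset d n k →
    ∃ j m, 1 ≤ j ∧ j ≤ k ∧ m ≤ d - 1 ∧ (c = mPlus d n k j m ∨ c = mMinus d n k j m) := by
  induction k, hk using Nat.le_induction with
  | base =>
    rintro c - ⟨m, hm, hc⟩
    exact ⟨1, m, le_rfl, le_rfl, hm, by rwa [mPlus, mMinus, if_pos rfl, if_pos rfl]⟩
  | succ k hk ih =>
    intro c hkn hc
    obtain ⟨k, rfl⟩ := Nat.exists_eq_add_of_le' hk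
    rcases hc with ⟨m, hm, hc⟩ | ⟨c, hc, rfl⟩
    · exact ⟨k + 2, m, by omega, le_rfl, hm, by simpa [mPlus, mMinus] using hc⟩
    · obtain ⟨j, m, hj, hjk, hm, h⟩ := ih (by omega) hc
      refine ⟨j, m, hj, by omega, hm, ?_⟩
      rw [mPlus_succ hjk, mMinus_succ hj hjk (by omega)]
      rcases h with rfl | rfl
      exacts [.inl rfl, .inr rfl]

end Spanning

namespace IsIncl

variable {d n : ℕ} {inc : YB d n →ₐ[Kf] YB d (n + 1)}

theorem map_bY (h : IsIncl d n inc) : inc (bY d n) = bY d (n + 1) := h.1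

theorem map_gY (h : IsIncl d n inc) {i : ℕ} (hi : 1 ≤ i) (hin : i ≤ n - 1) :
    inc (gY d n i) = gY d (n + 1) i := h.2.1 i hi hin

theorem map_tY (h : IsIncl d n inc) {j : ℕ} (hj : 1 ≤ j) (hjn : j ≤ n) :
    inc (tY d n j) = tY d (n + 1) j := h.2.2 j hj hjn

theorem map_tZ (h : IsIncl d n inc) {j : ℕ} (hj : 1 ≤ j) (hjn : j ≤ n) (r : ZMod d) :
    inc (tZ d n j r) = tZ d (n + 1) j r := by
  rw [tZ, map_pow, h.map_tY hj hjn, tZ]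

theorem map_gRange (h : IsIncl d n inc) {j k : ℕ} (hj : 1 ≤ j) (hjk : j ≤ k) : k ≤ n →
    inc (gRange d n j k) = gRange d (n + 1) j k := by
  induction k, hjk using Nat.le_induction with
  | base => simp [gRange_self]
  | succ k hk ih =>
    intro hkn
    rw [gRange_succ hk, gRange_succ hk, map_mul, ih (by omega), h.map_gY (by omega) (by omega)]

theorem map_mPlus (h : IsIncl d n inc) {j k : ℕ} (hj : 1 ≤ j) (hjk : j ≤ k) (hkn : k ≤ n)
    (m : ℕ) : inc (mPlus d n k j m) = mPlus d (n + 1) k j m := by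
  rw [mPlus, mPlus]
  split_ifs
  · rw [map_pow, h.map_tY (by omega) hkn]
  · rw [map_mul, map_pow, h.map_tY hj (by omega), h.map_gRange hj hjk hkn]

variable [NeZero d]

theorem map_gInv (h : IsIncl d n inc) {i : ℕ} (hi : 1 ≤ i) (hin : i ≤ n - 1) :
    inc (gInv d n i) = gInv d (n + 1) i := by
  rw [gInv_eq hi hin, gInv_eq hi (by omega), map_sub, map_smul, map_sum, h.map_gY hi hin]
  congr 2
  refine Finset.sum_congr rfl fun r _ => ?_
  rw [map_mul, h.map_tZ hi (by omega), h.map_tZ (by omega) (by omega)]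

theorem map_bk (h : IsIncl d n inc) {k : ℕ} (hk : 1 ≤ k) : k ≤ n →
    inc (bk d n k) = bk d (n + 1) k := by
  induction k, hk using Nat.le_induction with
  | base => exact fun _ => h.map_bY
  | succ k hk ih =>
    intro hkn
    rw [bk_succ hk, bk_succ hk, map_mul, map_mul, ih (by omega), h.map_gY hk (by omega),
      h.map_gInv hk (by omega)]

theorem map_mMinus (h : IsIncl d n inc) {j k : ℕ} (hj : 1 ≤ j) (hjk : j ≤ k) (hkn : k ≤ n)
    (m : ℕ) : inc (mMinus d n k j m) = mMinus d (n + 1) k j m := by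
  rw [mMinus, mMinus]
  split_ifs
  · rw [map_mul, map_pow, h.map_tY (by omega) hkn, h.map_bk (by omega) hkn]
  · rw [map_mul, map_mul, map_pow, h.map_tY hj (by omega), h.map_gRange hj hjk hkn,
      h.map_bk hj (by omega)]

theorem map_mem_Mset (h : IsIncl d n inc) {k : ℕ} (hk : 1 ≤ k) : ∀ {c : YB d n}, k ≤ n →
    c ∈ Mset d n k → inc c ∈ Mset d (n + 1) k := by
  induction k, hk using Nat.le_induction with
  | base =>
    rintro c hn ⟨m, hm, hc⟩
    refine ⟨m, hm, hc.imp ?_ ?_⟩ <;> rintro rfl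
    · rw [map_pow, h.map_tY le_rfl hn]
    · rw [map_mul, map_pow, h.map_tY le_rfl hn, h.map_bY]
  | succ k hk ih =>
    intro c hkn hc
    obtain ⟨k, rfl⟩ := Nat.exists_eq_add_of_le' hk
    rcases hc with ⟨m, hm, hc⟩ | ⟨c, hc, rfl⟩
    · refine .inl ⟨m, hm, hc.imp ?_ ?_⟩ <;> rintro rfl
      · rw [map_pow, h.map_tY (by omega) hkn]
      · rw [map_mul, map_pow, h.map_tY (by omega) hkn, h.map_bk (by omega) hkn]
    · exact .inr ⟨inc c, ih (by omega) hc, by rw [map_mul, h.map_gY (by omega) (by omega)]⟩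

theorem map_mul_mem_Cset (h : IsIncl d n inc) {w : YB d n} (hw : w ∈ Cset d n)
    {c : YB d (n + 1)} (hc : c ∈ Mset d (n + 1) (n + 1)) : inc w * c ∈ Cset d (n + 1) := by
  obtain ⟨f, hf, rfl⟩ := hw
  refine ⟨Fin.snoc (fun i => inc (f i)) c, fun i => ?_, ?_⟩
  · refine Fin.lastCases ?_ (fun i => ?_) i
    · simpa using hc
    · simpa using h.map_mem_Mset (by omega) (by omega) (hf i)
  · rw [List.ofFn_succ', List.prod_concat, map_list_prod, List.map_ofFn]
    simp [Function.comp_def]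

/-- The products `w c` with `w ∈ 𝖢_n` and `c ∈ M_{d,n+1}` span. -/
theorem span_Cset_succ (h : IsIncl d n inc) (hC : Submodule.span Kf (Cset d n) = ⊤)
    (hM : Submodule.span Kf {X | ∃ a, ∃ c ∈ Mset d (n + 1) (n + 1), X = inc a * c} = ⊤) :
    Submodule.span Kf (Cset d (n + 1)) = ⊤ := by
  rw [eq_top_iff, ← hM, Submodule.span_le]
  rintro _ ⟨a, c, hc, rfl⟩
  have ha : a ∈ Submodule.span Kf (Cset d n) := hC ▸ Submodule.mem_top
  induction ha using Submodule.span_induction with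
  | mem w hw => exact Submodule.subset_span (h.map_mul_mem_Cset hw hc)
  | zero => simp
  | add w w' _ _ hw hw' => rw [map_add, add_mul]; exact add_mem hw hw'
  | smul k w _ hw => rw [map_smul, smul_mul_assoc]; exact Submodule.smul_mem _ _ hw

/-- The generators of two consecutive strands form a braid step. -/
theorem braidStep (h : IsIncl d n inc) (hn : 1 ≤ n) :
    BraidStep (kap d) inc (tZ d n n) (bk d n n) (tZ d (n + 1) (n + 1)) (bk d (n + 1) (n + 1))
      (gY d (n + 1) n) where
  T₀_add := tZ_add hn le_rfl
  T₀_b₀ r := commute_tZ (tY_bk_commute hn le_rfl hn le_rfl) r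
  T_zero := tZ_zero _
  T_add := tZ_add (by omega) le_rfl
  T_map r a := by
    have ha : a ∈ Algebra.adjoin Kf (gens d n) := adjoin_gens d n ▸ Algebra.mem_top
    induction ha using Algebra.adjoin_induction with
    | mem X hX =>
      refine commute_tZ ?_ r
      rcases hX with rfl | ⟨i, hi, hin, rfl⟩ | ⟨j, hj, hjn, rfl⟩
      · rw [h.map_bY]
        exact tY_bY_commute (by omega) le_rfl
      · rw [h.map_gY hi hin, Commute, SemiconjBy, tY_gY hi (by omega) (by omega) le_rfl,
          sAct_of_ne (by omega) (by omega)]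
      · rw [h.map_tY hj hjn]
        exact tY_commute (by omega) le_rfl hj (by omega)
    | algebraMap k => rw [AlgHom.commutes]; exact (Algebra.commutes _ _).symm
    | add X Y _ _ hX hY => rw [map_add, mul_add, add_mul, hX, hY]
    | mul X Y _ _ hX hY => rw [map_mul, ← mul_assoc, hX, mul_assoc, hY, mul_assoc]
  T_b r := commute_tZ (tY_bk_commute (by omega) le_rfl (by omega) le_rfl) r
  T_g r := by
    rw [h.map_tZ hn le_rfl, tZ_gY hn (by omega) (by omega) le_rfl, sAct_succ]
  g_T r := by
    rw [h.map_tZ hn le_rfl, tZ_gY hn (by omega) hn (by omega), sAct_self]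
  g_sq := by
    rw [gY_sq hn (by omega), ← smul_mul_assoc, smul_eY hn (by omega), smul_mul_assoc, twistSum]
    simp only [h.map_tZ hn le_rfl]
  b_g := by rw [h.map_bk hn le_rfl, bk_succ_mul_gY hn (by omega)]
  quad := by rw [h.map_bk hn le_rfl, gY_bk_quad hn (by omega)]

end IsIncl

namespace IsRelTrace

variable {d n : ℕ} {x y : ZMod d → Kf} {inc : YB d n →ₐ[Kf] YB d (n + 1)}
  {tr : YB d (n + 1) →ₗ[Kf] YB d n}

theorem apply_of_forall_mem_Cset (hC : Submodule.span Kf (Cset d n) = ⊤) {c : YB d (n + 1)}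
    {c₀ : YB d n} {k : Kf} (h : ∀ w ∈ Cset d n, tr (inc w * c) = k • (w * c₀)) (X : YB d n) :
    tr (inc X * c) = k • (X * c₀) := by
  have hX : X ∈ Submodule.span Kf (Cset d n) := hC ▸ Submodule.mem_top
  induction hX using Submodule.span_induction with
  | mem w hw => exact h w hw
  | zero => simp
  | add X Y _ _ hX hY => simp only [map_add, add_mul, smul_add, hX, hY]
  | smul l X _ hX => rw [map_smul, smul_mul_assoc, map_smul, hX, smul_mul_assoc, smul_comm]

variable [NeZero d]

theorem apply_T (h : IsRelTrace d x y n inc tr) (hC : Submodule.span Kf (Cset d n) = ⊤)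
    (X : YB d n) (r : ZMod d) : tr (inc X * tZ d (n + 1) (n + 1) r) = x r • X := by
  have := apply_of_forall_mem_Cset (c := tZ d (n + 1) (n + 1) r) (c₀ := 1) (k := x r) (inc := inc)
    (tr := tr) hC
    (fun w hw => ?_) X
  · rwa [mul_one] at this
  · have := (h w hw r.val (Nat.le_sub_one_of_lt r.val_lt)).1
    rwa [ZMod.natCast_zmod_val, ← tZ, ← mul_one (x r • w), smul_mul_assoc] at this

theorem apply_Tb (h : IsRelTrace d x y n inc tr) (hC : Submodule.span Kf (Cset d n) = ⊤)
    (X : YB d n) (r : ZMod d) :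
    tr (inc X * (tZ d (n + 1) (n + 1) r * bk d (n + 1) (n + 1))) = y r • X := by
  have := apply_of_forall_mem_Cset (c := tZ d (n + 1) (n + 1) r * bk d (n + 1) (n + 1)) (c₀ := 1)
    (k := y r) (inc := inc) (tr := tr) hC (fun w hw => ?_) X
  · rwa [mul_one] at this
  · have := (h w hw r.val (Nat.le_sub_one_of_lt r.val_lt)).2.1
    rwa [ZMod.natCast_zmod_val, ← tZ, ← (commute_tZ (tY_bk_commute (by omega) le_rfl (by omega)
      le_rfl) r).eq, ← mul_one (y r • w), smul_mul_assoc] at this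

theorem apply_g_Mset (h : IsRelTrace d x y n inc tr) (hinc : IsIncl d n inc) (hn : 1 ≤ n)
    (hC : Submodule.span Kf (Cset d n) = ⊤) (X : YB d n) {c : YB d n} (hc : c ∈ Mset d n n) :
    tr (inc X * (gY d (n + 1) n * inc c)) = zz • (X * c) := by
  refine apply_of_forall_mem_Cset hC (fun w hw => ?_) X
  obtain ⟨j, m, hj, hjn, hm, rfl | rfl⟩ := exists_eq_of_mem_Mset hn le_rfl hc
  · rw [hinc.map_mPlus hj hjn le_rfl, ← mPlus_succ hjn]
    exact ((h w hw m hm).2.2 j hj hjn).1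
  · rw [hinc.map_mMinus hj hjn le_rfl, ← mMinus_succ hj hjn (by omega)]
    exact ((h w hw m hm).2.2 j hj hjn).2

theorem apply_g (h : IsRelTrace d x y n inc tr) (hinc : IsIncl d n inc) (hn : 1 ≤ n)
    (hC : Submodule.span Kf (Cset d n) = ⊤) {A : Type*} [Ring A] [Algebra Kf A]
    {i : A →ₐ[Kf] YB d n} (hi : ∀ a, Commute (gY d (n + 1) n) (inc (i a)))
    (hM : Submodule.span Kf {X | ∃ a, ∃ c ∈ Mset d n n, X = i a * c} = ⊤) (X Y : YB d n) :
    tr (inc X * (gY d (n + 1) n * inc Y)) = zz • (X * Y) := by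
  have hY : Y ∈ Submodule.span Kf {X | ∃ a, ∃ c ∈ Mset d n n, X = i a * c} :=
    hM ▸ Submodule.mem_top
  induction hY using Submodule.span_induction with
  | mem Y hY =>
    obtain ⟨a, c, hc, rfl⟩ := hY
    rw [map_mul inc, ← mul_assoc (gY d _ _), (hi a).eq, mul_assoc, ← mul_assoc, ← map_mul inc,
      h.apply_g_Mset hinc hn hC _ hc, mul_assoc]
  | zero => simp
  | add Y Z _ _ hY hZ => simp only [map_add, mul_add, smul_add, hY, hZ]
  | smul l Y _ hY => simp only [map_smul, mul_smul_comm, hY, smul_comm l]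

end IsRelTrace

/-- The submonoid generated by the braiding generators. -/
def braidSubmonoid (d n : ℕ) : Submonoid (YB d n) :=
  Submonoid.closure {X | ∃ i, 1 ≤ i ∧ i ≤ n - 1 ∧ X = gY d n i}

namespace IsIncl

variable {d n : ℕ} {inc : YB d n →ₐ[Kf] YB d (n + 1)}

theorem gY_commute_map_map {inc₂ : YB d (n + 1) →ₐ[Kf] YB d (n + 1 + 1)} (h : IsIncl d n inc)
    (h₂ : IsIncl d (n + 1) inc₂) (hn : 1 ≤ n) (X : YB d n) :
    Commute (gY d (n + 1 + 1) (n + 1)) (inc₂ (inc X)) := by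
  have hX : X ∈ Algebra.adjoin Kf (gens d n) := adjoin_gens d n ▸ Algebra.mem_top
  induction hX using Algebra.adjoin_induction with
  | mem X hX =>
    rcases hX with rfl | ⟨i, hi, hin, rfl⟩ | ⟨j, hj, hjn, rfl⟩
    · rw [h.map_bY, h₂.map_bY]
      exact (bY_gY_commute (by omega) (by omega)).symm
    · rw [h.map_gY hi hin, h₂.map_gY hi (by omega)]
      exact gY_commute (by omega) (by omega) hi (by omega) (.inr (by omega))
    · rw [h.map_tY hj hjn, h₂.map_tY hj (by omega), Commute, SemiconjBy,
        tY_gY (by omega) (by omega) hj (by omega), sAct_of_ne (by omega) (by omega)]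
  | algebraMap k => rw [AlgHom.commutes, AlgHom.commutes]; exact (Algebra.commutes _ _).symm
  | add X Y _ _ hX hY => rw [map_add, map_add]; exact hX.add_right hY
  | mul X Y _ _ hX hY => rw [map_mul, map_mul]; exact hX.mul_right hY

theorem map_mem_braidSubmonoid (h : IsIncl d n inc) {X : YB d n} (hX : X ∈ braidSubmonoid d n) :
    inc X ∈ braidSubmonoid d (n + 1) := by
  induction hX using Submonoid.closure_induction with
  | mem X hX =>
    obtain ⟨i, hi, hin, rfl⟩ := hX
    exact Submonoid.subset_closure ⟨i, hi, by omega, h.map_gY hi hin⟩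
  | one => rw [map_one]; exact one_mem _
  | mul X Y _ _ hX hY => rw [map_mul]; exact mul_mem hX hY

theorem adjoin_range_eq_top (h : IsIncl d n inc) (hn : 1 ≤ n) :
    Algebra.adjoin Kf (Set.range inc ∪ ({gY d (n + 1) n} ∪ Set.range (tZ d (n + 1) (n + 1)))) =
      ⊤ := by
  rw [eq_top_iff, ← adjoin_gens]
  refine Algebra.adjoin_mono ?_
  rintro _ (rfl | ⟨i, hi, hin, rfl⟩ | ⟨j, hj, hjn, rfl⟩)
  · exact .inl ⟨_, h.map_bY⟩
  · obtain rfl | hin : i = n ∨ i ≤ n - 1 := by omega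
    · exact .inr (.inl rfl)
    · exact .inl ⟨_, h.map_gY hi hin⟩
  · obtain rfl | hjn : j = n + 1 ∨ j ≤ n := by omega
    · exact .inr (.inr ⟨((1 : ℕ) : ZMod d), by rw [tZ_natCast hj le_rfl, pow_one]⟩)
    · exact .inl ⟨_, h.map_tY hj hjn⟩

variable [NeZero d]

theorem bk_mul_map_braidSubmonoid (h : IsIncl d n inc) {X : YB d n}
    (hX : X ∈ braidSubmonoid d n) : Commute (bk d (n + 1) (n + 1)) (inc X) := by
  induction hX using Submonoid.closure_induction with
  | mem X hX =>
    obtain ⟨i, hi, hin, rfl⟩ := hX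
    rw [h.map_gY hi hin]
    exact (gY_bk_commute_of_add_two_le hi (by omega) le_rfl).symm
  | one => rw [map_one]; exact Commute.one_right _
  | mul X Y _ _ hX hY => rw [map_mul]; exact hX.mul_right hY

end IsIncl

section Bottom

variable {d : ℕ}

theorem mem_center (X : YB d 1) : X ∈ Subalgebra.center Kf (YB d 1) := by
  have hg : gens d 1 ⊆ Subalgebra.centralizer Kf (gens d 1) := by
    rintro X hX
    refine Subalgebra.mem_centralizer_iff Kf |>.2 ?_
    rintro Y hY
    rcases hX with rfl | ⟨i, hi, hin, rfl⟩ | ⟨j, hj, hjn, rfl⟩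
    · rcases hY with rfl | ⟨i, hi, hin, rfl⟩ | ⟨j, hj, hjn, rfl⟩
      · rfl
      · omega
      · exact (tY_bY_commute hj hjn).eq
    · omega
    · rcases hY with rfl | ⟨i, hi, hin, rfl⟩ | ⟨k, hk, hkn, rfl⟩
      · exact (tY_bY_commute hj hjn).eq.symm
      · omega
      · exact (tY_commute hk hkn hj hjn).eq
  have h₁ : ∀ Y, Y ∈ Subalgebra.centralizer Kf (gens d 1) := fun Y =>
    Algebra.adjoin_le hg (adjoin_gens d 1 ▸ Algebra.mem_top)
  have h₂ : gens d 1 ⊆ Subalgebra.center Kf (YB d 1) := fun Y hY =>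
    Subalgebra.mem_center_iff.2 fun Z => ((Subalgebra.mem_centralizer_iff Kf).1 (h₁ Z) Y hY).symm
  exact Algebra.adjoin_le h₂ (adjoin_gens d 1 ▸ Algebra.mem_top)

theorem Mset_one_subset_Cset : Mset d 1 1 ⊆ Cset d 1 := fun c hc =>
  ⟨fun _ => c, fun i => by fin_cases i; exact hc, by simp⟩

variable [NeZero d]

theorem tZ_mem_Mset_one (r : ZMod d) : tZ d 1 1 r ∈ Mset d 1 1 :=
  ⟨r.val, Nat.le_sub_one_of_lt r.val_lt, .inl rfl⟩

theorem tZ_mul_bY_mem_Mset_one (r : ZMod d) : tZ d 1 1 r * bY d 1 ∈ Mset d 1 1 :=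
  ⟨r.val, Nat.le_sub_one_of_lt r.val_lt, .inr rfl⟩

theorem tZ_mul_tY_one (r : ZMod d) : tZ d 1 1 r * tY d 1 1 = tZ d 1 1 (r + 1) := by
  have := tZ_natCast (d := d) (n := 1) le_rfl le_rfl 1
  rw [Nat.cast_one, pow_one] at this
  rw [tZ_add le_rfl le_rfl, this]

theorem span_Mset_one : Submodule.span Kf (Mset d 1 1) = ⊤ := by
  have key : ∀ X W : YB d 1, W ∈ Submodule.span Kf (Mset d 1 1) →
      W * X ∈ Submodule.span Kf (Mset d 1 1) := by
    intro X
    have hX : X ∈ Algebra.adjoin Kf (gens d 1) := adjoin_gens d 1 ▸ Algebra.mem_top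
    induction hX using Algebra.adjoin_induction with
    | mem X hX =>
      intro W hW
      induction hW using Submodule.span_induction with
      | mem W hW =>
        obtain ⟨m, -, hW⟩ := hW
        rw [← tZ_natCast le_rfl le_rfl] at hW
        generalize (m : ZMod d) = r at hW
        rcases hX with rfl | ⟨i, hi, hin, rfl⟩ | ⟨j, hj, hjn, rfl⟩
        · rcases hW with rfl | rfl
          · exact Submodule.subset_span (tZ_mul_bY_mem_Mset_one r)
          · rw [mul_assoc, bY_sq, mul_add, mul_one, mul_smul_comm, fY, fF, map_smul, map_sum,
              smul_mul_assoc, mul_smul_comm, Finset.sum_mul, Finset.mul_sum]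
            refine add_mem (Submodule.subset_span (tZ_mem_Mset_one r)) (Submodule.smul_mem _ _
              (Submodule.smul_mem _ _ (sum_mem fun k _ => Submodule.subset_span ?_)))
            rw [map_pow]
            change tZ d 1 1 r * (tY d 1 1 ^ k * bY d 1) ∈ _
            rw [← tZ_natCast le_rfl le_rfl, ← mul_assoc, ← tZ_add le_rfl le_rfl]
            exact tZ_mul_bY_mem_Mset_one _
        · omega
        · obtain rfl : j = 1 := by omega
          refine Submodule.subset_span ?_
          rcases hW with rfl | rfl
          · rw [tZ_mul_tY_one]
            exact tZ_mem_Mset_one _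
          · rw [mul_assoc, ← (tY_bY_commute le_rfl le_rfl).eq, ← mul_assoc, tZ_mul_tY_one]
            exact tZ_mul_bY_mem_Mset_one _
      | zero => rw [zero_mul]; exact zero_mem _
      | add U V _ _ hU hV => rw [add_mul]; exact add_mem hU hV
      | smul k U _ hU => rw [smul_mul_assoc]; exact Submodule.smul_mem _ _ hU
    | algebraMap k =>
      intro W hW
      rw [← Algebra.commutes, ← Algebra.smul_def]
      exact Submodule.smul_mem _ _ hW
    | add X Y _ _ hX hY => intro W hW; rw [mul_add]; exact add_mem (hX W hW) (hY W hW)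
    | mul X Y _ _ hX hY => intro W hW; rw [← mul_assoc]; exact hY _ (hX W hW)
  refine Submodule.eq_top_iff'.2 fun X => ?_
  have h₁ := Submodule.subset_span (R := Kf) (tZ_mem_Mset_one (d := d) 0)
  rw [tZ_zero] at h₁
  simpa using key X 1 h₁

theorem bottom_floor {x y : ZMod d → Kf} {tr1 : YB d 1 →ₗ[Kf] Kf} (h : IsTr1 d x y tr1) :
    Floor (kap d) zz x y (Algebra.ofId Kf (YB d 1)) tr1 1 1 (tZ d 1 1) (bk d 1 1) ∅ ∅ where
  T_zero := tZ_zero 1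
  T_add := tZ_add le_rfl le_rfl
  T_map r a := (Algebra.commutes a _).symm
  T_b r := commute_tZ (tY_bY_commute le_rfl le_rfl) r
  b_map r a := by
    change _ * (_ * algebraMap _ _ a) - algebraMap _ _ a * _ ∈ _
    rw [← mul_assoc, Algebra.commutes, sub_self]
    exact zero_mem _
  subsingleton := Set.subsingleton_empty
  braid := by simp
  b_H := by simp
  τ_T a r := by
    change tr1 (algebraMap _ _ a * _) = _
    rw [← Algebra.smul_def, map_smul, tZ, (h r.val (Nat.le_sub_one_of_lt r.val_lt)).1,
      ZMod.natCast_zmod_val, smul_eq_mul, smul_eq_mul, mul_comm]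
  τ_Tb a r := by
    change tr1 (algebraMap _ _ a * (_ * bY d 1)) = _
    rw [← Algebra.smul_def, map_smul, (commute_tZ (tY_bY_commute le_rfl le_rfl) r).eq, tZ,
      (h r.val (Nat.le_sub_one_of_lt r.val_lt)).2, ZMod.natCast_zmod_val, smul_eq_mul,
      smul_eq_mul, mul_comm]
  τ_g := by simp
  span_eq_top := by
    rw [eq_top_iff, ← span_Mset_one, Submodule.span_le]
    rintro _ ⟨m, -, hc⟩
    rw [← tZ_natCast le_rfl le_rfl] at hc
    exact Submodule.subset_span ⟨1, _, hc.imp (fun h => by rw [h, map_one, one_mul])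
      fun h => .inl (by rw [h, map_one, one_mul]; rfl)⟩

end Bottom

/-- The properties of the `m`-th floor `A → Y_{d,m+1}^B` of the tower from which the next floor is
built. -/
structure TowerLevel (d : ℕ) [NeZero d] (x y : ZMod d → Kf)
    (inc : (k : ℕ) → (YB d k →ₐ[Kf] YB d (k + 1))) (θ : (m : ℕ) → YB d (m + 1) →ₗ[Kf] Kf)
    (m : ℕ) {A : Type} [Ring A] [Algebra Kf A] (i : A →ₐ[Kf] YB d (m + 1))
    (τ : YB d (m + 1) →ₗ[Kf] A) (T₀ : ZMod d → A) (b₀ : A) (G : Set (YB d (m + 1))) (H : Set A)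
    (θ₀ : A →ₗ[Kf] Kf) : Prop where
  floor : Floor (kap d) zz x y i τ T₀ b₀ (tZ d (m + 1) (m + 1)) (bk d (m + 1) (m + 1)) G H
  trace_eq : ∀ X, θ m X = θ₀ (τ X)
  trace_comm : ∀ X Y, θ m (X * Y) = θ m (Y * X)
  twist : ∀ g ∈ G, ∀ a, τ (twistSum i T₀ (tZ d (m + 1) (m + 1)) * (g * (i a * g))) =
    τ (g * (i a * g) * twistSum i T₀ (tZ d (m + 1) (m + 1)))
  g_map : ∀ a, Commute (gY d (m + 2) (m + 1)) (inc (m + 1) (i a))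
  eq_of_mem : ∀ g ∈ G, 1 ≤ m ∧ g = gY d (m + 1) m
  map_mem : ∀ h ∈ H, i h ∈ braidSubmonoid d (m + 1)
  loop : m = 0 ∨ ∃ a, i a = bY d (m + 1)
  span_Cset : Submodule.span Kf (Cset d (m + 1)) = ⊤
  span_Mset : Submodule.span Kf {X | ∃ a, ∃ c ∈ Mset d (m + 1) (m + 1), X = i a * c} = ⊤

namespace TowerLevel

variable {d : ℕ} [NeZero d] {x y : ZMod d → Kf}
  {inc : (k : ℕ) → (YB d k →ₐ[Kf] YB d (k + 1))}

theorem bottom {tr1 : YB d 1 →ₗ[Kf] Kf} {tr : (k : ℕ) → (YB d (k + 2) →ₗ[Kf] YB d (k + 1))}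
    (h : IsTr1 d x y tr1) :
    TowerLevel d x y inc (TrT d tr1 tr) 0 (Algebra.ofId Kf (YB d 1)) tr1 1 1 ∅ ∅
      LinearMap.id where
  floor := bottom_floor h
  trace_eq _ := rfl
  trace_comm X Y := by rw [Subalgebra.mem_center_iff.1 (mem_center X) Y]
  twist := by simp
  g_map a := by
    rw [Algebra.ofId_apply, AlgHom.commutes]
    exact (Algebra.commutes _ _).symm
  eq_of_mem := by simp
  map_mem := by simp
  loop := .inl rfl
  span_Cset := by
    rw [eq_top_iff, ← span_Mset_one]
    exact Submodule.span_mono Mset_one_subset_Cset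
  span_Mset := by
    rw [eq_top_iff, ← span_Mset_one]
    exact Submodule.span_mono fun c hc => ⟨1, c, hc, by rw [map_one, one_mul]⟩

variable {θ : (m : ℕ) → YB d (m + 1) →ₗ[Kf] Kf} {m : ℕ} {A : Type} [Ring A] [Algebra Kf A]
  {i : A →ₐ[Kf] YB d (m + 1)} {τ : YB d (m + 1) →ₗ[Kf] A} {T₀ : ZMod d → A} {b₀ : A}
  {G : Set (YB d (m + 1))} {H : Set A} {θ₀ : A →ₗ[Kf] Kf}

theorem braid_rel (L : TowerLevel d x y inc θ m i τ T₀ b₀ G H θ₀)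
    (hinc : IsIncl d (m + 1) (inc (m + 1))) (g : YB d (m + 1)) (hg : g ∈ G) :
    gY d (m + 2) (m + 1) * (inc (m + 1) g * gY d (m + 2) (m + 1)) =
      inc (m + 1) g * (gY d (m + 2) (m + 1) * inc (m + 1) g) := by
  obtain ⟨hm, rfl⟩ := L.eq_of_mem g hg
  rw [hinc.map_gY hm (by omega), gY_braid hm (by omega)]

theorem b_map (L : TowerLevel d x y inc θ m i τ T₀ b₀ G H θ₀)
    (hinc : IsIncl d (m + 1) (inc (m + 1))) (r : ZMod d) (X : YB d (m + 1)) :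
    tZ d (m + 2) (m + 2) r * (bk d (m + 2) (m + 2) * inc (m + 1) X) -
      inc (m + 1) X * (tZ d (m + 2) (m + 2) r * bk d (m + 2) (m + 2)) ∈
        slideSpan (inc (m + 1)) {gY d (m + 2) (m + 1)} := by
  have hbr := hinc.braidStep (by omega)
  refine BraidStep.b_map_of_adjoin (adjoin_gens d (m + 1)) (fun X hX r => ?_) r X
  have of_commute : Commute (bk d (m + 2) (m + 2)) (inc (m + 1) X) →
      tZ d (m + 2) (m + 2) r * (bk d (m + 2) (m + 2) * inc (m + 1) X) -
      inc (m + 1) X * (tZ d (m + 2) (m + 2) r * bk d (m + 2) (m + 2)) ∈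
        slideSpan (inc (m + 1)) {gY d (m + 2) (m + 1)} := by
    intro h
    rw [h.eq, hbr.T_map_assoc, sub_self]
    exact zero_mem _
  rcases hX with rfl | ⟨k, hk, hkm, rfl⟩ | ⟨k, hk, hkm, rfl⟩
  · obtain rfl | ⟨a, ha⟩ := L.loop
    · exact hbr.loop_comm_mem r
    · rw [← ha]
      refine hbr.b_map_map (fun a => (L.g_map a).eq) (L.braid_rel hinc) (fun g hg => ?_)
        L.floor.b_map r a
      obtain ⟨hm, rfl⟩ := L.eq_of_mem g hg
      exact ⟨gInv d (m + 1) m, gY_mul_gInv hm (by omega), gInv_mul_gY hm (by omega)⟩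
  · refine of_commute ?_
    rw [hinc.map_gY hk hkm]
    exact (gY_bk_commute_of_add_two_le hk (by omega) le_rfl).symm
  · refine of_commute ?_
    rw [hinc.map_tY hk hkm]
    exact (tY_bk_commute (by omega) le_rfl hk (by omega)).symm

theorem floorStep (L : TowerLevel d x y inc θ m i τ T₀ b₀ G H θ₀)
    (hinc : IsIncl d (m + 1) (inc (m + 1))) :
    FloorStep (kap d) i (tZ d (m + 1) (m + 1)) (bk d (m + 1) (m + 1)) G H (inc (m + 1))
      (tZ d (m + 2) (m + 2)) (bk d (m + 2) (m + 2)) (gY d (m + 2) (m + 1))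
      (braidSubmonoid d (m + 1)) where
  braid := hinc.braidStep (by omega)
  g_map a := (L.g_map a).eq
  braid_rel := L.braid_rel hinc
  b_map := L.b_map hinc
  one_mem := one_mem _
  mul_mem g hg h hh := by
    obtain ⟨hm, rfl⟩ := L.eq_of_mem g hg
    exact mul_mem (Submonoid.subset_closure ⟨m, hm, by omega, rfl⟩) (L.map_mem h hh)
  b_H h hh := (hinc.bk_mul_map_braidSubmonoid hh).eq
  adjoin_eq_top := hinc.adjoin_range_eq_top (by omega)

theorem span_Mset_succ (L : TowerLevel d x y inc θ m i τ T₀ b₀ G H θ₀)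
    (hinc : IsIncl d (m + 1) (inc (m + 1))) :
    Submodule.span Kf {X | ∃ a, ∃ c ∈ Mset d (m + 2) (m + 2), X = inc (m + 1) a * c} = ⊤ := by
  rw [eq_top_iff, ← (L.floorStep hinc).wordSpan_eq_top L.floor]
  refine Submodule.span_le.2 ?_
  rintro Z (⟨X, r, rfl⟩ | ⟨X, r, rfl⟩ | ⟨X, Y, rfl⟩)
  · exact Submodule.subset_span
      ⟨X, _, .inl ⟨r.val, Nat.le_sub_one_of_lt r.val_lt, .inl rfl⟩, rfl⟩
  · exact Submodule.subset_span
      ⟨X, _, .inl ⟨r.val, Nat.le_sub_one_of_lt r.val_lt, .inr rfl⟩, rfl⟩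
  · have hY : Y ∈ Submodule.span Kf {X | ∃ a, ∃ c ∈ Mset d (m + 1) (m + 1), X = i a * c} :=
      L.span_Mset ▸ Submodule.mem_top
    rw [SetLike.mem_coe]
    induction hY using Submodule.span_induction with
    | mem Y hY =>
      obtain ⟨a, c, hc, rfl⟩ := hY
      refine Submodule.subset_span ⟨X * i a, gY d (m + 2) (m + 1) * inc (m + 1) c,
        .inr ⟨_, hinc.map_mem_Mset (by omega) le_rfl hc, rfl⟩, ?_⟩
      rw [map_mul, ← mul_assoc (gY d _ _), (L.g_map a).eq, map_mul]
      simp only [mul_assoc]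
    | zero => simp
    | add Y Z _ _ hY hZ => rw [map_add, mul_add, mul_add]; exact add_mem hY hZ
    | smul k Y _ hY =>
      rw [map_smul, mul_smul_comm, mul_smul_comm]; exact Submodule.smul_mem _ _ hY

theorem succ (L : TowerLevel d x y inc θ m i τ T₀ b₀ G H θ₀) (hinc : ∀ k, 1 ≤ k → IsIncl d k (inc k))
    {σ : YB d (m + 2) →ₗ[Kf] YB d (m + 1)} (hσ : IsRelTrace d x y (m + 1) (inc (m + 1)) σ)
    (hθ : ∀ X, θ (m + 1) X = θ m (σ X)) :
    TowerLevel d x y inc θ (m + 1) (inc (m + 1)) σ (tZ d (m + 1) (m + 1)) (bk d (m + 1) (m + 1))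
      {gY d (m + 2) (m + 1)} (braidSubmonoid d (m + 1)) (θ m) := by
  have h := hinc (m + 1) (by omega)
  have S := L.floorStep h
  have F := S.floor L.floor (hσ.apply_T L.span_Cset) (hσ.apply_Tb L.span_Cset)
    (hσ.apply_g h (by omega) L.span_Cset L.g_map L.span_Mset)
  have hM := L.span_Mset_succ h
  exact
    { floor := F
      trace_eq := hθ
      trace_comm := fun X Y => by
        rw [hθ, hθ, S.trace_comm L.floor F L.trace_eq L.trace_comm L.twist]
      twist := by rintro _ rfl a; exact S.twist_step L.floor F a
      g_map := h.gY_commute_map_map (hinc (m + 2) (by omega)) (by omega)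
      eq_of_mem := by rintro _ rfl; exact ⟨by omega, rfl⟩
      map_mem := fun X hX => h.map_mem_braidSubmonoid hX
      loop := .inr ⟨_, h.map_bY⟩
      span_Cset := h.span_Cset_succ L.span_Cset hM
      span_Mset := hM }

theorem all {tr1 : YB d 1 →ₗ[Kf] Kf} {tr : (k : ℕ) → (YB d (k + 2) →ₗ[Kf] YB d (k + 1))}
    (hinc : ∀ k, 1 ≤ k → IsIncl d k (inc k)) (htr1 : IsTr1 d x y tr1)
    (htr : ∀ k, IsRelTrace d x y (k + 1) (inc (k + 1)) (tr k)) (m : ℕ) :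
    TowerLevel d x y inc (TrT d tr1 tr) (m + 1) (inc (m + 1)) (tr m) (tZ d (m + 1) (m + 1))
      (bk d (m + 1) (m + 1)) {gY d (m + 2) (m + 1)} (braidSubmonoid d (m + 1))
      (TrT d tr1 tr m) := by
  induction m with
  | zero => exact (bottom htr1).succ hinc (htr 0) fun _ => rfl
  | succ m ih => exact ih.succ hinc (htr (m + 1)) fun _ => rfl

end TowerLevel


/-- `Tr = {Tr_n}` is a Markov trace on the tower `{Y_{d,n}^B}_{n ≥ 1}`
(here `Tr_n` is `TrT d tr1 tr (n - 1) : Y_{d,n}^B → L`): (i) `Tr_n(1) = 1`;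
(ii) `Tr_{n+1}(X g_n) = z Tr_n(X)`; (iii) `Tr_{n+1}(X b_{n+1} t_{n+1}^m) = y_m Tr_n(X)`;
(iv) `Tr_{n+1}(X t_{n+1}^m) = x_m Tr_n(X)`; (v) `Tr_n(XY) = Tr_n(YX)`. -/
theorem stmt17 (d : ℕ) (hd : 1 ≤ d)
    (x y : ZMod d → Kf) (hx0 : x 0 = 1) (hx : ∀ i, x i ≠ 0) (hy : ∀ i, y i ≠ 0)
    (inc : (k : ℕ) → (YB d k →ₐ[Kf] YB d (k + 1))) (hinc : ∀ k, 1 ≤ k → IsIncl d k (inc k))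
    (tr1 : YB d 1 →ₗ[Kf] Kf) (htr1 : IsTr1 d x y tr1)
    (tr : (k : ℕ) → (YB d (k + 2) →ₗ[Kf] YB d (k + 1)))
    (htr : ∀ k, IsRelTrace d x y (k + 1) (inc (k + 1)) (tr k)) :
    (∀ m : ℕ, TrT d tr1 tr m 1 = 1) ∧
    (∀ (m : ℕ) (X : YB d (m + 1)),
      TrT d tr1 tr (m + 1) (inc (m + 1) X * gY d (m + 2) (m + 1)) =
        zz * TrT d tr1 tr m X) ∧
    (∀ (m : ℕ) (X : YB d (m + 1)) (a : ℕ), a ≤ d - 1 →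
      TrT d tr1 tr (m + 1)
          (inc (m + 1) X * (bk d (m + 2) (m + 2) * tY d (m + 2) (m + 2) ^ a)) =
        y (a : ZMod d) * TrT d tr1 tr m X) ∧
    (∀ (m : ℕ) (X : YB d (m + 1)) (a : ℕ), a ≤ d - 1 →
      TrT d tr1 tr (m + 1) (inc (m + 1) X * tY d (m + 2) (m + 2) ^ a) =
        x (a : ZMod d) * TrT d tr1 tr m X) ∧
    (∀ (m : ℕ) (X Y : YB d (m + 1)),
      TrT d tr1 tr m (X * Y) = TrT d tr1 tr m (Y * X)) := by
  have : NeZero d := ⟨by omega⟩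
  have L := TowerLevel.all hinc htr1 htr
  refine ⟨fun m => ?_, fun m X => ?_, fun m X a _ => ?_, fun m X a _ => ?_, fun m X Y => ?_⟩
  · induction m with
    | zero =>
      have := (htr1 0 (Nat.zero_le _)).1
      rwa [pow_zero, Nat.cast_zero, hx0] at this
    | succ m ih =>
      have := (L m).floor.τ_T 1 0
      rw [(L m).floor.T_zero, map_one, one_mul, hx0, one_smul] at this
      rw [(L m).trace_eq, this, ih]
  · have := (L m).floor.τ_g _ rfl X 1
    rw [map_one, mul_one, mul_one] at this
    rw [(L m).trace_eq, this, map_smul, smul_eq_mul]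
  · rw [← ((tY_bk_commute (by omega) le_rfl (by omega) le_rfl).pow_left a).eq,
      ← tZ_natCast (by omega) le_rfl, (L m).trace_eq, (L m).floor.τ_Tb, map_smul, smul_eq_mul]
  · rw [← tZ_natCast (by omega) le_rfl, (L m).trace_eq, (L m).floor.τ_T, map_smul, smul_eq_mul]
  · cases m with
    | zero => exact (TowerLevel.bottom (inc := inc) (tr := tr) htr1).trace_comm X Y
    | succ m => exact (L m).trace_comm X Y
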